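/- There is an absolute constant C > 0 such that for all integers n, d, k ≥ 1 and every finite field 𝔽, the number of affine varieties in 𝔽̄^n of degree d and dimension k that are defined over 𝔽 is at most |𝔽|^{n·C·d·binom(k+d+2, k)}. -/

import Mathlib

open MvPolynomial

/-- The zero locus of a set of multivariate polynomials. -/
def zeroLocus (K : Type*) [Field K] (n : ℕ) (S : Set (MvPolynomial (Fin n) K)) :
    Set (Fin n → K) := {x | ∀ f ∈ S, eval x f = 0}

/-- An affine variety is the common zero set of finitely many polynomials. -/
def IsAffineVariety (K : Type*) [Field K] (n : ℕ) (V : Set (Fin n → K)) : Prop :=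
  ∃ s : Finset (MvPolynomial (Fin n) K), V = zeroLocus K n ↑s

/-- The Zariski topology on affine n-space. -/
instance zariskiTopology (K : Type*) [Field K] (n : ℕ) : TopologicalSpace (Fin n → K) :=
  TopologicalSpace.generateFrom
    {U | ∃ S : Set (MvPolynomial (Fin n) K), U = (zeroLocus K n S)ᶜ}

/-- Dimension of a subset of affine space: Krull dimension in the Zariski topology. -/
noncomputable def vdim (K : Type*) [Field K] (n : ℕ) (V : Set (Fin n → K)) : WithBot ℕ∞ :=
  topologicalKrullDim ↥V

/-- An affine-linear subspace: zero set of polynomials of degree at most one. -/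
def IsAffineSubspace (K : Type*) [Field K] (n : ℕ) (L : Set (Fin n → K)) : Prop :=
  ∃ S : Set (MvPolynomial (Fin n) K), (∀ f ∈ S, totalDegree f ≤ 1) ∧ L = zeroLocus K n S

/-- Degree of an irreducible variety: number of intersection points with a generic
(affine-linear) subspace of complementary dimension. -/
noncomputable def irrDegree (K : Type*) [Field K] (n : ℕ) (W : Set (Fin n → K)) : ℕ∞ :=
  ⨆ (L : Set (Fin n → K)) (_ : IsAffineSubspace K n L)
    (_ : vdim K n W + vdim K n L = (n : WithBot ℕ∞)) (_ : (W ∩ L).Finite),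
    ((W ∩ L).ncard : ℕ∞)

/-- Degree of a variety: sum of degrees of its irreducible components. -/
noncomputable def vdeg (K : Type*) [Field K] (n : ℕ) (V : Set (Fin n → K)) : ℕ∞ :=
  ∑' W : irreducibleComponents ↥V, irrDegree K n (Subtype.val '' (W.1 : Set ↥V))

/-- The ideal of polynomials vanishing on a set. -/
noncomputable def vanishingIdeal (K : Type*) [Field K] (n : ℕ) (V : Set (Fin n → K)) :
    Ideal (MvPolynomial (Fin n) K) where
  carrier := {f | ∀ x ∈ V, eval x f = 0}
  add_mem' {f g} hf hg := fun x hx => by simp [hf x hx, hg x hx]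
  zero_mem' := fun x hx => by simp
  smul_mem' := fun c f hf x hx => by simp [hf x hx]

/-- A variety is defined over a subfield `F` if its vanishing ideal is generated by
finitely many polynomials with coefficients in `F`. -/
def DefinedOver (F K : Type*) [Field F] [Field K] [Algebra F K] (n : ℕ)
    (V : Set (Fin n → K)) : Prop :=
  ∃ s : Finset (MvPolynomial (Fin n) F),
    vanishingIdeal K n V = Ideal.span ((MvPolynomial.map (algebraMap F K)) '' ↑s)

open MvPolynomial

namespace CV
open Polynomial

/-- Extending homs into an algebraically closed field along integral maps. -/
theorem ext_integral {R A Ω : Type} [CommRing R] [CommRing A] [Algebra R A] [Algebra.IsIntegral R A]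
    [Field Ω] [IsAlgClosed Ω] (θ : R →+* Ω)
    (hk : RingHom.ker (algebraMap R A) ≤ RingHom.ker θ) :
    ∃ θ' : A →+* Ω, θ'.comp (algebraMap R A) = θ := by
  have hp : (RingHom.ker θ).IsPrime := RingHom.ker_isPrime θ
  obtain ⟨P, -, hP, hc⟩ := Ideal.exists_ideal_over_prime_of_isIntegral (RingHom.ker θ) (⊥ : Ideal A)
    (by intro x hx; exact hk (by simpa [RingHom.mem_ker] using hx))
  letI : Algebra (R ⧸ RingHom.ker θ) (A ⧸ P) := Ideal.Quotient.algebraQuotientOfLEComap hc.ge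
  letI : Algebra (R ⧸ RingHom.ker θ) Ω := (RingHom.kerLift θ).toAlgebra
  have hinj : Function.Injective (algebraMap (R ⧸ RingHom.ker θ) (A ⧸ P)) :=
    Ideal.quotientMap_injective' hc.le
  have hinj2 : Function.Injective (algebraMap (R ⧸ RingHom.ker θ) Ω) :=
    RingHom.kerLift_injective θ
  haveI : Module.IsTorsionFree (R ⧸ RingHom.ker θ) (A ⧸ P) := by
    rw [Module.isTorsionFree_iff_algebraMap_injective]; exact hinj
  haveI : Module.IsTorsionFree (R ⧸ RingHom.ker θ) Ω := by
    rw [Module.isTorsionFree_iff_algebraMap_injective]; exact hinj2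
  haveI : Algebra.IsIntegral (R ⧸ RingHom.ker θ) (A ⧸ P) := by
    refine ⟨fun x => ?_⟩
    obtain ⟨a, rfl⟩ := Ideal.Quotient.mk_surjective x
    obtain ⟨p, hp, hpa⟩ := Algebra.IsIntegral.isIntegral (R := R) a
    refine ⟨p.map (Ideal.Quotient.mk _), hp.map _, ?_⟩
    rw [Polynomial.eval₂_map]
    have : (algebraMap (R ⧸ RingHom.ker θ) (A ⧸ P)).comp (Ideal.Quotient.mk _) =
      (Ideal.Quotient.mk P).comp (algebraMap R A) := rfl
    rw [this, ← Polynomial.hom_eval₂, hpa, map_zero]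
  let e : (A ⧸ P) →ₐ[R ⧸ RingHom.ker θ] Ω := IsAlgClosed.lift
  refine ⟨e.toRingHom.comp (Ideal.Quotient.mk P), ?_⟩
  ext r
  have := e.commutes (Ideal.Quotient.mk _ r)
  exact this

/-- Monic prime `F`, `h` not a multiple: eliminate the variable. -/
theorem elim_var {C : Type} [CommRing C] [IsDomain C] {F h : C[X]} (hm : F.Monic) (hF : Prime F)
    (hh : ¬ F ∣ h) : ∃ r : C, r ≠ 0 ∧ ∃ u w : C[X], Polynomial.C r = F * u + h * w := by
  have hp : (Ideal.span {F}).IsPrime := (Ideal.span_singleton_prime hF.ne_zero).2 hF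
  have hx : Ideal.Quotient.mk (Ideal.span {F}) h ≠ 0 := by
    rw [Ne, Ideal.Quotient.eq_zero_iff_mem, Ideal.mem_span_singleton]; exact hh
  have hIntegral : Algebra.IsIntegral C (C[X] ⧸ Ideal.span {F}) := by
    have := hm.quotient_isIntegral (I := Ideal.span {F}) (Ideal.subset_span rfl)
    exact ⟨this⟩
  have := Ideal.comap_ne_bot_of_integral_mem (R := C) hx
    (I := Ideal.span {Ideal.Quotient.mk (Ideal.span {F}) h}) (Ideal.subset_span rfl)
    (Algebra.IsIntegral.isIntegral _)
  obtain ⟨r, hr, hr0⟩ := Submodule.exists_mem_ne_zero_of_ne_bot this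
  refine ⟨r, hr0, ?_⟩
  rw [Ideal.mem_comap, Ideal.mem_span_singleton] at hr
  obtain ⟨c, hc⟩ := hr
  obtain ⟨w, rfl⟩ := Ideal.Quotient.mk_surjective c
  have h1 : Ideal.Quotient.mk (Ideal.span {F}) (Polynomial.C r) =
    Ideal.Quotient.mk (Ideal.span {F}) (h * w) := by rw [map_mul, ← hc]; rfl
  rw [Ideal.Quotient.eq, Ideal.mem_span_singleton] at h1
  obtain ⟨u, hu⟩ := h1
  exact ⟨u, w, by rw [← hu]; ring⟩

/-- `B` is a localization of the integral closure when generators become integral. -/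
theorem ext_away {C B Ω : Type} [CommRing C] [CommRing B] [IsDomain B] [Algebra C B] [Field Ω]
    (g : C) (hg : algebraMap C B g ≠ 0)
    (hb : ∀ b : B, ∃ N : ℕ, IsIntegral C (algebraMap C B g ^ N * b))
    (θ : integralClosure C B →+* Ω) (hθ : θ (algebraMap C _ g) ≠ 0) :
    ∃ e : B →+* Ω, ∀ a : integralClosure C B, e a = θ a := by
  set gA : integralClosure C B := algebraMap C _ g with hgA
  set gB : B := algebraMap C B g
  have hgAB : algebraMap (integralClosure C B) B gA = gB := rfl
  have hloc : IsLocalization (Submonoid.powers gA) (Localization.Away gB) := by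
    refine ⟨?_, ?_, ?_⟩
    · rintro ⟨_, N, rfl⟩
      have : IsUnit (algebraMap B (Localization.Away gB) gB) :=
        IsLocalization.Away.algebraMap_isUnit gB
      simp only [map_pow]
      refine IsUnit.pow _ ?_
      rwa [IsScalarTower.algebraMap_apply (integralClosure C B) B, hgAB]
    · intro z
      obtain ⟨⟨b, ⟨_, M, rfl⟩⟩, hz⟩ := IsLocalization.surj (Submonoid.powers gB) z
      obtain ⟨N, hN⟩ := hb b
      refine ⟨⟨⟨gB ^ N * b, hN⟩, ⟨gA ^ (N + M), N + M, rfl⟩⟩, ?_⟩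
      simp only at hz ⊢
      rw [IsScalarTower.algebraMap_apply (integralClosure C B) B (Localization.Away gB),
        IsScalarTower.algebraMap_apply (integralClosure C B) B (Localization.Away gB),
        map_pow, hgAB]
      change _ = algebraMap B _ (gB ^ N * b)
      rw [map_mul, ← hz, pow_add, map_mul]; ring
    · intro x y hxy
      refine ⟨1, ?_⟩
      have hle : Submonoid.powers gB ≤ nonZeroDivisors B :=
        powers_le_nonZeroDivisors_of_noZeroDivisors hg
      have h2 := IsLocalization.injective (Localization.Away gB) hle hxy
      have : x = y := Subtype.ext h2
      rw [this]
  have hu : ∀ y : Submonoid.powers gA, IsUnit (θ y) := by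
    rintro ⟨_, N, rfl⟩
    simpa using IsUnit.pow N (isUnit_iff_ne_zero.2 hθ)
  refine ⟨(IsLocalization.lift (S := Localization.Away gB) hu).comp (algebraMap B _), fun a => ?_⟩
  have := IsLocalization.lift_eq (S := Localization.Away gB) hu a
  rw [← this]
  rfl

end CV

open MvPolynomial

namespace CV
open Polynomial

theorem exists_eval_ne {σ K : Type} [Field K] [Infinite K] (p : MvPolynomial σ K) (hp : p ≠ 0) :
    ∃ a : σ → K, MvPolynomial.eval a p ≠ 0 := by
  by_contra! h
  exact hp (MvPolynomial.funext (fun x => by simpa using h x))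

theorem core {σ K B : Type} [Finite σ] [Field K] [IsAlgClosed K] [CommRing B] [IsDomain B]
    [Algebra K B] [Algebra.FiniteType K B] [Algebra (MvPolynomial σ K) B]
    [IsScalarTower K (MvPolynomial σ K) B]
    (hinj : Function.Injective (algebraMap (MvPolynomial σ K) B))
    [Algebra.IsAlgebraic (MvPolynomial σ K) B] (z : B) (F : (MvPolynomial σ K)[X])
    (hm : F.Monic) (hF : Prime F) (hz : aeval z F = 0) (hsep : derivative F ≠ 0) :
    ∃ a : σ → K, {e : B →ₐ[K] K | ∀ s, e (algebraMap (MvPolynomial σ K) B (MvPolynomial.X s)) = a s}.Finite ∧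
      F.natDegree ≤ {e : B →ₐ[K] K | ∀ s, e (algebraMap (MvPolynomial σ K) B (MvPolynomial.X s)) = a s}.ncard := by
  classical
  have hinf : Infinite K := IsAlgClosed.instInfinite
  obtain ⟨t, ht⟩ := (Algebra.FiniteType.out : (⊤ : Subalgebra K B).FG)
  obtain ⟨g, hg0, hg⟩ := Algebra.IsAlgebraic.exists_integral_multiples (MvPolynomial σ K) (A := B) t
  set gB := algebraMap (MvPolynomial σ K) B g with hgB
  have hgB0 : gB ≠ 0 := fun h => hg0 (hinj (by rw [map_zero]; exact h))
  have hgi : IsIntegral (MvPolynomial σ K) gB := isIntegral_algebraMap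
  have hb : ∀ b : B, ∃ N : ℕ, IsIntegral (MvPolynomial σ K) (gB ^ N * b) := by
    intro b
    have hbt : b ∈ Algebra.adjoin K (t : Set B) := by rw [ht]; trivial
    induction hbt using Algebra.adjoin_induction with
    | mem x hx => exact ⟨1, by simpa [Algebra.smul_def] using hg x hx⟩
    | algebraMap r =>
      refine ⟨0, ?_⟩
      rw [IsScalarTower.algebraMap_apply K (MvPolynomial σ K) B]
      simpa using isIntegral_algebraMap
    | add x y _ _ hx hy =>
      obtain ⟨N, hN⟩ := hx
      obtain ⟨M, hM⟩ := hy
      refine ⟨N + M, ?_⟩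
      have : gB ^ (N + M) * (x + y) = gB ^ M * (gB ^ N * x) + gB ^ N * (gB ^ M * y) := by ring
      rw [this]
      exact ((hgi.pow _).mul hN).add ((hgi.pow _).mul hM)
    | mul x y _ _ hx hy =>
      obtain ⟨N, hN⟩ := hx
      obtain ⟨M, hM⟩ := hy
      refine ⟨N + M, ?_⟩
      have : gB ^ (N + M) * (x * y) = (gB ^ N * x) * (gB ^ M * y) := by ring
      rw [this]
      exact hN.mul hM
  have hnd : ¬ F ∣ derivative F :=
    hm.not_dvd_of_degree_lt hsep (degree_derivative_lt hF.ne_zero)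
  obtain ⟨r, hr0, u, w, hr⟩ := elim_var hm hF hnd
  obtain ⟨a, ha⟩ := exists_eval_ne (r * g) (mul_ne_zero hr0 hg0)
  rw [map_mul] at ha
  have hra : MvPolynomial.eval a r ≠ 0 := left_ne_zero_of_mul ha
  have hga : MvPolynomial.eval a g ≠ 0 := right_ne_zero_of_mul ha
  have hcomp : ∀ e : B →ₐ[K] K, (∀ s, e (algebraMap (MvPolynomial σ K) B (MvPolynomial.X s)) = a s) →
      ∀ c : MvPolynomial σ K, e (algebraMap (MvPolynomial σ K) B c) = MvPolynomial.eval a c := by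
    intro e he c
    have : (e.toRingHom.comp (algebraMap (MvPolynomial σ K) B)) = MvPolynomial.eval a := by
      apply MvPolynomial.ringHom_ext
      · intro k
        have := e.commutes k
        rw [IsScalarTower.algebraMap_apply K (MvPolynomial σ K) B] at this
        simpa using this
      · intro s; simpa using he s
    exact congrArg (fun f => f c) this
  have hEfin : {e : B →ₐ[K] K | ∀ s, e (algebraMap (MvPolynomial σ K) B (MvPolynomial.X s)) = a s}.Finite := by
    have hfin : ∀ b : t, ∃ T : Set K, T.Finite ∧ ∀ e : B →ₐ[K] K,
        (∀ s, e (algebraMap (MvPolynomial σ K) B (MvPolynomial.X s)) = a s) → e b ∈ T := by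
      intro b
      obtain ⟨p, hp, hpb⟩ := hg b b.2
      refine ⟨(fun x => x / MvPolynomial.eval a g) '' ((p.map (MvPolynomial.eval a)).roots.toFinset : Set K),
        (Finset.finite_toSet _).image _, fun e he => ?_⟩
      refine ⟨MvPolynomial.eval a g * e b, ?_, by field_simp⟩
      simp only [Finset.mem_coe, Multiset.mem_toFinset]
      rw [mem_roots (hp.map _).ne_zero, IsRoot.def, Polynomial.eval_map]
      have h1 := congrArg e hpb
      rw [map_zero] at h1
      have h2 := Polynomial.hom_eval₂ p (algebraMap (MvPolynomial σ K) B) e.toRingHom (g • (b : B))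
      have h3 : e.toRingHom.comp (algebraMap (MvPolynomial σ K) B) = MvPolynomial.eval a := by
        exact RingHom.ext (hcomp e he)
      rw [h3] at h2
      have h4 : e.toRingHom (g • (b : B)) = MvPolynomial.eval a g * e b := by
        rw [Algebra.smul_def]
        change e _ = _
        rw [map_mul, hcomp e he]
      rw [h4] at h2
      rw [← h2]; exact h1
    choose T hT hTe using hfin
    refine Set.Finite.of_finite_image (f := fun (e : B →ₐ[K] K) (b : t) => e b)
      ((Set.Finite.pi hT).subset ?_) ?_
    · rintro _ ⟨e, he, rfl⟩ b _
      exact hTe b e he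
    · intro e _ e' _ hee
      refine AlgHom.ext_of_adjoin_eq_top ht (fun x hx => ?_)
      exact congrFun hee ⟨x, hx⟩
  refine ⟨a, hEfin, ?_⟩
  set Fa := F.map (MvPolynomial.eval a) with hFa
  have hFam : Fa.Monic := hm.map _
  have hFad : Fa.natDegree = F.natDegree := hm.natDegree_map _
  have hcop : Fa.Separable := by
    have h1 := congrArg (Polynomial.map (MvPolynomial.eval a)) hr
    simp only [Polynomial.map_C, Polynomial.map_add, Polynomial.map_mul, ← derivative_map] at h1
    refine ⟨Polynomial.C (MvPolynomial.eval a r)⁻¹ * u.map (MvPolynomial.eval a),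
      Polynomial.C (MvPolynomial.eval a r)⁻¹ * w.map (MvPolynomial.eval a), ?_⟩
    have h2 : (1 : K[X]) = Polynomial.C (MvPolynomial.eval a r)⁻¹ * Polynomial.C (MvPolynomial.eval a r) := by
      rw [← Polynomial.C_mul, inv_mul_cancel₀ hra, Polynomial.C_1]
    rw [h2, h1]; ring
  have hcard : Fa.roots.toFinset.card = F.natDegree := by
    rw [Multiset.toFinset_card_of_nodup (nodup_roots hcop), ← hFad]
    exact (IsAlgClosed.splits Fa).natDegree_eq_card_roots.symm
  rw [← hcard, ← Set.ncard_coe_finset]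
  refine le_trans (Set.ncard_le_ncard (t := (fun e : B →ₐ[K] K => e z) '' {e : B →ₐ[K] K | ∀ s, e (algebraMap (MvPolynomial σ K) B (MvPolynomial.X s)) = a s}) ?_ (hEfin.image _)) (Set.ncard_image_le hEfin)
  intro ζ hζ
  simp only [Finset.mem_coe, Multiset.mem_toFinset] at hζ
  rw [mem_roots hFam.ne_zero, IsRoot.def, Polynomial.eval_map] at hζ
  have hzint : IsIntegral (MvPolynomial σ K) z := ⟨F, hm, hz⟩
  let A' := integralClosure (MvPolynomial σ K) B
  let z' : A' := ⟨z, hzint⟩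
  let alg : Algebra (MvPolynomial σ K)[X] A' := (aeval (R := MvPolynomial σ K) z').toRingHom.toAlgebra
  have halg : ∀ p : (MvPolynomial σ K)[X], algebraMap (MvPolynomial σ K)[X] A' p = aeval z' p := fun _ => rfl
  have hval : ∀ p : (MvPolynomial σ K)[X], ((aeval z' p : A') : B) = aeval z p := by
    intro p
    have := Polynomial.aeval_algHom_apply A'.val z' p
    exact this.symm
  have tow : IsScalarTower (MvPolynomial σ K) (MvPolynomial σ K)[X] A' := by
    refine IsScalarTower.of_algebraMap_eq (fun x => ?_)
    rw [halg]
    simp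
  have hIntegral : Algebra.IsIntegral (MvPolynomial σ K)[X] A' := 
    ⟨fun x => (Algebra.IsIntegral.isIntegral (R := MvPolynomial σ K) x).tower_top⟩
  obtain ⟨θ', hθ'⟩ := ext_integral (A := A') (eval₂RingHom (MvPolynomial.eval a) ζ) (by
    intro p hp
    rw [RingHom.mem_ker, halg] at hp
    have hp' : aeval z p = 0 := by rw [← hval, hp]; rfl
    have hdvd : F ∣ p := by
      by_contra hn
      obtain ⟨r', hr', u', w', h⟩ := elim_var hm hF hn
      have := congrArg (Polynomial.aeval z) h
      rw [map_add, map_mul, map_mul, hz, hp', zero_mul, zero_mul, add_zero, Polynomial.aeval_C] at this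
      exact hr' (hinj (by rw [this, map_zero]))
    obtain ⟨q, rfl⟩ := hdvd
    rw [RingHom.mem_ker, map_mul]
    simp [hζ])
  have hθC : ∀ c : MvPolynomial σ K, θ' (algebraMap (MvPolynomial σ K) A' c) = MvPolynomial.eval a c := by
    intro c
    have := congrArg (fun f => f (Polynomial.C c)) hθ'
    simpa [halg] using this
  have hθz : θ' z' = ζ := by
    have := congrArg (fun f => f Polynomial.X) hθ'
    simpa [halg] using this
  obtain ⟨e, he⟩ := ext_away g hgB0 hb θ' (by rw [hθC]; exact hga)
  have heC : ∀ c : MvPolynomial σ K, e (algebraMap (MvPolynomial σ K) B c) = MvPolynomial.eval a c := by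
    intro c
    rw [← hθC, ← he]; rfl
  refine ⟨{ e with commutes' := fun k => ?_ }, fun s => ?_, ?_⟩
  · change e _ = _
    rw [IsScalarTower.algebraMap_apply K (MvPolynomial σ K) B, heC]
    simp
  · change e _ = _
    rw [heC]; simp
  · change e _ = _
    rw [← hθz, ← he]

end CV

open MvPolynomial
namespace CV

theorem coeff_pderiv_single {τ K : Type} [Field K] [DecidableEq τ] (f : MvPolynomial τ K) (i : τ)
    (m : τ →₀ ℕ) : coeff m (pderiv i f) = coeff (m + Finsupp.single i 1) f * (m i + 1) := by
  induction f using MvPolynomial.induction_on' with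
  | monomial u a =>
    rw [pderiv_monomial, coeff_monomial, coeff_monomial]
    by_cases h : u = m + Finsupp.single i 1
    · subst h
      simp
    · rw [if_neg h]
      by_cases h2 : u - Finsupp.single i 1 = m
      · rw [if_pos h2]
        have : u i = 0 := by
          by_contra h3
          apply h
          rw [← h2]
          ext j
          by_cases hj : j = i
          · subst hj; simp; omega
          · simp [Finsupp.single_apply, Ne.symm hj]
        simp [this]
      · simp [h2]
  | add p q hp hq => simp [hp, hq, add_mul]

theorem sep {τ K : Type} [Field K] [IsAlgClosed K] (p : ℕ) [Fact p.Prime] [CharP K p]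
    (f : MvPolynomial τ K) (hf : Irreducible f) : ∃ i, pderiv i f ≠ 0 := by
  classical
  by_contra! h
  have hdvd : ∀ m ∈ f.support, ∀ i, p ∣ m i := by
    intro m hm i
    by_contra hmi
    have h1 : m i ≠ 0 := fun h0 => hmi (by simp [h0])
    have h2 := coeff_pderiv_single f i (m - Finsupp.single i 1)
    rw [h i, coeff_zero] at h2
    have h3 : m - Finsupp.single i 1 + Finsupp.single i 1 = m := by
      ext j
      by_cases hj : j = i
      · subst hj; simp; omega
      · simp [Finsupp.single_apply, Ne.symm hj]
    rw [h3] at h2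
    have h4 : (((m - Finsupp.single i 1 : τ →₀ ℕ) i : ℕ) : K) + 1 = (m i : K) := by
      have : (m - Finsupp.single i 1 : τ →₀ ℕ) i + 1 = m i := by simp; omega
      rw [← this]; push_cast; rfl
    rw [h4] at h2
    rcases mul_eq_zero.1 h2.symm with h5 | h5
    · exact (mem_support_iff.1 hm) h5
    · exact hmi ((CharP.cast_eq_zero_iff K p _).1 h5)
  haveI : ExpChar K p := ExpChar.prime Fact.out
  haveI : ExpChar (MvPolynomial τ K) p := inferInstance
  have hroot : ∀ c : K, ∃ b, b ^ p = c := fun c => IsAlgClosed.exists_pow_nat_eq c (Fact.out : p.Prime).pos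
  choose r hr using hroot
  let g : MvPolynomial τ K := ∑ m ∈ f.support, monomial (m.mapRange (· / p) (by simp)) (r (coeff m f))
  have hg : g ^ p = f := by
    have : g ^ p = frobenius (MvPolynomial τ K) p g := rfl
    rw [this, map_sum]
    conv_rhs => rw [f.as_sum]
    refine Finset.sum_congr rfl fun m hm => ?_
    rw [frobenius_def, monomial_pow, hr]
    congr 2
    refine Finsupp.ext fun i => ?_
    simp [Nat.mul_div_cancel' (hdvd m hm i)]
  rw [← hg] at hf
  exact not_irreducible_pow (Nat.Prime.one_lt Fact.out).ne' hf
end CV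

open MvPolynomial
namespace CV

theorem lin_aeval {τ K A : Type} [Fintype τ] [Field K] [CommRing A] [Algebra K A]
    (g : τ → Polynomial A) (u : τ → K) (hg : ∀ i, (g i).natDegree ≤ 1)
    (hu : ∀ i, (g i).coeff 1 = algebraMap K A (u i)) (f : MvPolynomial τ K) :
    (aeval g f).natDegree ≤ f.totalDegree ∧
      (aeval g f).coeff f.totalDegree =
        algebraMap K A (eval u (homogeneousComponent f.totalDegree f)) := by
  classical
  have key : ∀ m : τ →₀ ℕ, (∏ i, g i ^ m i).natDegree ≤ m.degree ∧
      (∏ i, g i ^ m i).coeff m.degree = algebraMap K A (∏ i, u i ^ m i) := by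
    intro m
    have : ∀ s : Finset τ, (∏ i ∈ s, g i ^ m i).natDegree ≤ ∑ i ∈ s, m i ∧
      (∏ i ∈ s, g i ^ m i).coeff (∑ i ∈ s, m i) = algebraMap K A (∏ i ∈ s, u i ^ m i) := by
      intro s
      induction s using Finset.induction_on with
      | empty => simp
      | insert a s ha ih =>
        have h1 : (g a ^ m a).natDegree ≤ m a := by
          refine Polynomial.natDegree_pow_le.trans ?_
          have := hg a
          nlinarith
        rw [Finset.prod_insert ha, Finset.sum_insert ha, Finset.prod_insert ha]
        refine ⟨Polynomial.natDegree_mul_le.trans (add_le_add h1 ih.1), ?_⟩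
        rw [Polynomial.coeff_mul_add_eq_of_natDegree_le h1 ih.1, ih.2, map_mul]
        congr 1
        have := Polynomial.coeff_pow_of_natDegree_le (m := m a) (hg a)
        rw [mul_one] at this
        rw [this, hu, map_pow]
    have h := this Finset.univ
    rwa [← Finsupp.degree_eq_sum] at h
  have hdeg : ∀ m ∈ f.support, m.degree ≤ f.totalDegree := by
    intro m hm
    exact le_totalDegree hm
  rw [aeval_def, eval₂_eq']
  constructor
  · refine Polynomial.natDegree_sum_le_of_forall_le _ _ fun m hm => ?_
    rw [Polynomial.algebraMap_apply] 
    exact (Polynomial.natDegree_C_mul_le _ _).trans ((key m).1.trans (hdeg m hm))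
  · rw [Polynomial.finset_sum_coeff, homogeneousComponent_apply, map_sum, map_sum, Finset.sum_filter]
    refine Finset.sum_congr rfl fun m hm => ?_
    rw [Polynomial.algebraMap_apply, Polynomial.coeff_C_mul]
    split_ifs with h
    · rw [← h, (key m).2, eval_monomial, map_mul, Finsupp.prod_fintype _ _ (by simp)]
    · rw [Polynomial.coeff_eq_zero_of_natDegree_lt, mul_zero]
      exact (key m).1.trans_lt (lt_of_le_of_ne (hdeg m hm) h)

theorem deriv_aeval {τ K A : Type} [Fintype τ] [Field K] [CommRing A] [Algebra K A]
    (g : τ → Polynomial A) (u : τ → K)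
    (hu : ∀ i, Polynomial.derivative (g i) = algebraMap K _ (u i)) (f : MvPolynomial τ K) :
    Polynomial.derivative (aeval g f) = aeval g (∑ i, C (u i) * pderiv i f) := by
  classical
  induction f using MvPolynomial.induction_on with
  | C a =>
    simp only [algHom_C, pderiv_C, mul_zero, Finset.sum_const_zero, map_zero]
    rw [Polynomial.algebraMap_apply, Polynomial.derivative_C]
  | add p q hp hq => simp [hp, hq, mul_add, Finset.sum_add_distrib]
  | mul_X p i hp =>
    rw [map_mul, Polynomial.derivative_mul, hp, aeval_X, hu]
    simp only [Derivation.leibniz, smul_eq_mul, pderiv_X, mul_add, Finset.sum_add_distrib, map_add,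
      map_sum, map_mul, aeval_X, algHom_C]
    rw [add_comm, Finset.sum_mul]
    congr 1
    · rw [Finset.sum_eq_single i]
      · simp [mul_comm]
      · intro j _ hj
        simp [Pi.single_apply, Ne.symm hj]
      · simp
    · refine Finset.sum_congr rfl fun j _ => by ring
end CV

open MvPolynomial
namespace CV

theorem AL {σ K B : Type} [Fintype σ] [Field K] [IsAlgClosed K] (p : ℕ) [Fact p.Prime] [CharP K p]
    [CommRing B] [IsDomain B] [Algebra K B] [Algebra.FiniteType K B] (y : σ → B)
    (hy : AlgebraicIndependent K y)
    (halg : Algebra.IsAlgebraic (Algebra.adjoin K (Set.range y)) B) (z : B) :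
    ∃ f : MvPolynomial (Option σ) K, f ≠ 0 ∧ aeval (fun o : Option σ => o.elim z y) f = 0 ∧
      ∃ a v : σ → K, {e : B →ₐ[K] K | ∀ s, e (y s) = a s + v s * e z}.Finite ∧
        f.totalDegree ≤ {e : B →ₐ[K] K | ∀ s, e (y s) = a s + v s * e z}.ncard := by
  classical
  have hinf : Infinite K := IsAlgClosed.instInfinite
  have hytb : IsTranscendenceBasis K y := hy.isTranscendenceBasis_iff_isAlgebraic.2 halg
  set yz : Option σ → B := fun o => o.elim z y with hyz
  -- the relation ideal
  have hker : RingHom.ker (aeval (R := K) yz) ≠ ⊥ := by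
    intro hbot
    have hai : AlgebraicIndependent K yz := (RingHom.injective_iff_ker_eq_bot _).2 hbot
    have h1 := hai.cardinalMk_le_trdeg
    rw [← hytb.cardinalMk_eq_trdeg, Cardinal.mk_option, Cardinal.mk_fintype] at h1
    have h2 : Fintype.card σ + 1 ≤ Fintype.card σ := by exact_mod_cast h1
    omega
  have hkp : (RingHom.ker (aeval (R := K) yz)).IsPrime := RingHom.ker_isPrime _
  obtain ⟨f, hfk, hf⟩ := hkp.exists_mem_prime_of_ne_bot hker
  have hf0 : aeval yz f = 0 := hfk
  refine ⟨f, hf.ne_zero, hf0, ?_⟩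
  obtain ⟨i0, hi0⟩ := sep p f hf.irreducible
  obtain ⟨m0, hm0⟩ := MvPolynomial.ne_zero_iff.1 hi0
  set D := f.totalDegree with hD
  have htop : homogeneousComponent D f ≠ 0 := by
    intro h
    obtain ⟨m, hm, hmd⟩ := Finset.exists_mem_eq_sup f.support
      (support_nonempty.2 hf.ne_zero) (fun s => s.sum fun _ e => e)
    have := coeff_homogeneousComponent D f m
    rw [h, if_pos (by rw [hD]; exact hmd.symm), coeff_zero] at this
    exact (mem_support_iff.1 hm) this.symm
  set ℓ : MvPolynomial (Option σ) K := ∑ o, C (coeff m0 (pderiv o f)) * X o with hℓ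
  have hℓ0 : ℓ ≠ 0 := by
    intro h
    have h1 := congrArg (eval (Pi.single i0 1)) h
    rw [hℓ, map_sum, Finset.sum_eq_single i0] at h1
    · simp at h1
      exact hm0 h1
    · intro b _ hb
      simp [Pi.single_apply, hb]
    · simp
  obtain ⟨u, hu⟩ := exists_eval_ne (homogeneousComponent D f * X none * ℓ)
    (mul_ne_zero (mul_ne_zero htop (X_ne_zero _)) hℓ0)
  rw [map_mul, map_mul, eval_X] at hu
  have hut : eval u (homogeneousComponent D f) ≠ 0 := left_ne_zero_of_mul (left_ne_zero_of_mul hu)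
  have hun : u none ≠ 0 := right_ne_zero_of_mul (left_ne_zero_of_mul hu)
  have hul : eval u ℓ ≠ 0 := right_ne_zero_of_mul hu
  -- the shear
  let s1 : MvPolynomial (Option σ) K →ₐ[K] MvPolynomial (Option σ) K :=
    aeval (fun o => o.elim (C (u none) * X none) (fun s => X (some s) + C (u (some s)) * X none))
  let s2 : MvPolynomial (Option σ) K →ₐ[K] MvPolynomial (Option σ) K :=
    aeval (fun o => o.elim (C (u none)⁻¹ * X none)
      (fun s => X (some s) - C (u (some s) * (u none)⁻¹) * X none))
  have hCC : (C (u none) : MvPolynomial (Option σ) K) * C (u none)⁻¹ = 1 := by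
    rw [← C_mul, mul_inv_cancel₀ hun, C_1]
  have h12 : s1.comp s2 = AlgHom.id K _ := by
    ext o : 1
    cases o with
    | none => simp only [s1, s2, AlgHom.comp_apply, aeval_X, Option.elim, map_mul, algHom_C,
                algebraMap_eq, AlgHom.id_apply]; linear_combination X none * hCC
    | some s => simp only [s1, s2, AlgHom.comp_apply, aeval_X, Option.elim, map_mul, algHom_C,
                algebraMap_eq, AlgHom.id_apply, map_sub]
                linear_combination (- X none * C (u (some s))) * hCC
  have h21 : s2.comp s1 = AlgHom.id K _ := by
    ext o : 1
    cases o with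
    | none => simp only [s1, s2, AlgHom.comp_apply, aeval_X, Option.elim, map_mul, algHom_C,
                algebraMap_eq, AlgHom.id_apply]; linear_combination X none * hCC
    | some s => simp only [s1, s2, AlgHom.comp_apply, aeval_X, Option.elim, map_mul, algHom_C,
                algebraMap_eq, AlgHom.id_apply, map_add]
                ring
  let φ : MvPolynomial (Option σ) K ≃ₐ[K] Polynomial (MvPolynomial σ K) :=
    (AlgEquiv.ofAlgHom s1 s2 h12 h21).trans (optionEquivLeft K σ)
  let g : Option σ → Polynomial (MvPolynomial σ K) := fun o =>
    o.elim (Polynomial.C (C (u none)) * Polynomial.X)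
      (fun s => Polynomial.C (X s) + Polynomial.C (C (u (some s))) * Polynomial.X)
  have hφg : ∀ q, φ q = aeval g q := by
    have : (φ : MvPolynomial (Option σ) K →ₐ[K] Polynomial (MvPolynomial σ K)) = aeval g := by
      ext o : 1
      cases o with
      | none => simp [φ, s1, g]
      | some s => simp [φ, s1, g]
    intro q
    exact DFunLike.congr_fun this q
  have hg1 : ∀ o, (g o).natDegree ≤ 1 := by
    rintro (_ | s)
    · exact (Polynomial.natDegree_C_mul_le _ _).trans Polynomial.natDegree_X_le
    · simp only [g, Option.elim]
      rw [add_comm]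
      exact Polynomial.natDegree_linear_le
  have hgc : ∀ o, (g o).coeff 1 = algebraMap K (MvPolynomial σ K) (u o) := by
    rintro (_ | s) <;> simp [g, algebraMap_eq]
  have hgd : ∀ o, Polynomial.derivative (g o) = algebraMap K _ (u o) := by
    rintro (_ | s) <;> simp [g, algebraMap_eq, Polynomial.algebraMap_apply]
  obtain ⟨hdeg, hlc⟩ := lin_aeval g u hg1 hgc f
  have hder := deriv_aeval g u hgd f
  rw [← hφg] at hdeg hlc hder
  rw [← hφg] at hder
  have hderne : Polynomial.derivative (φ f) ≠ 0 := by
    rw [hder]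
    intro h
    rw [map_eq_zero_iff _ φ.injective] at h
    apply hul
    have := congrArg (coeff m0) h
    simp only [coeff_sum, coeff_C_mul, coeff_zero] at this
    rw [hℓ, map_sum, ← this]
    refine Finset.sum_congr rfl fun o _ => ?_
    simp [mul_comm]
  set c := eval u (homogeneousComponent D f) with hc
  have hnat : (φ f).natDegree = D := by
    refine le_antisymm hdeg (Polynomial.le_natDegree_of_ne_zero ?_)
    rw [hlc]; simpa [algebraMap_eq] using hut
  set F : Polynomial (MvPolynomial σ K) := Polynomial.C (C c⁻¹) * φ f with hF
  have hunit : IsUnit (Polynomial.C (C c⁻¹) : Polynomial (MvPolynomial σ K)) := by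
    refine IsUnit.map _ (IsUnit.map _ ?_)
    exact isUnit_iff_ne_zero.2 (inv_ne_zero hut)
  have hFprime : Prime F := by
    have h1 : Prime (φ f) := (MulEquiv.prime_iff φ).2 hf
    refine (Associated.prime_iff ?_).1 h1
    exact (associated_unit_mul_left _ _ hunit).symm
  have hFmonic : F.Monic := by
    rw [Polynomial.Monic, hF, Polynomial.leadingCoeff_mul, Polynomial.leadingCoeff_C,
      Polynomial.leadingCoeff, hnat, hlc, algebraMap_eq, ← C_mul, inv_mul_cancel₀ hut, C_1]
  have hFdeg : F.natDegree = D := by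
    rw [hF, Polynomial.natDegree_C_mul_of_isUnit, hnat]
    exact (isUnit_iff_ne_zero.2 (inv_ne_zero hut)).map _
  have hFder : Polynomial.derivative F ≠ 0 := by
    rw [hF, Polynomial.derivative_C_mul]
    exact mul_ne_zero hunit.ne_zero hderne
  -- the algebra structure
  let z' : B := (u none)⁻¹ • z
  let y' : σ → B := fun s => y s - u (some s) • z'
  let α : MvPolynomial σ K →ₐ[K] B := aeval y'
  have hFz : Polynomial.eval₂ α.toRingHom z' F = 0 := by
    have h1 : Polynomial.eval₂ α.toRingHom z' (φ f) = aeval yz f := by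
      have h2 : (Polynomial.eval₂RingHom α.toRingHom z').comp (φ : _ →+* _) =
          (aeval yz : _ →ₐ[K] B).toRingHom := by
        apply MvPolynomial.ringHom_ext
        · intro r
          simp [hφg, α, Polynomial.algebraMap_apply, algebraMap_eq]
        · rintro (_ | s)
          · simp [hφg, α, g, yz, z', algebraMap_eq, ← Algebra.smul_def, smul_smul, hun]
          · simp [hφg, α, g, yz, y', algebraMap_eq, ← Algebra.smul_def]
      exact DFunLike.congr_fun h2 f
    rw [hF, Polynomial.eval₂_mul, h1, hf0, mul_zero]
  have hαmem : ∀ q, α q ∈ Algebra.adjoin K (Set.range y') := by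
    intro q
    rw [Algebra.adjoin_range_eq_range_aeval]
    exact ⟨q, rfl⟩
  have hzint : IsIntegral (Algebra.adjoin K (Set.range y')) z' := by
    let α' : MvPolynomial σ K →ₐ[K] Algebra.adjoin K (Set.range y') := α.codRestrict _ hαmem
    refine ⟨F.map α'.toRingHom, hFmonic.map _, ?_⟩
    rw [Polynomial.eval₂_map]
    exact hFz
  have hle : Algebra.adjoin K (Set.range y) ≤
      (integralClosure (Algebra.adjoin K (Set.range y')) B).restrictScalars K := by
    refine Algebra.adjoin_le ?_
    rintro _ ⟨s, rfl⟩
    change IsIntegral _ (y s)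
    have h1 : y s = y' s + u (some s) • z' := by simp [y']
    rw [h1]
    refine IsIntegral.add ?_ (hzint.smul _)
    exact isIntegral_algebraMap (x := (⟨y' s, Algebra.subset_adjoin ⟨s, rfl⟩⟩ :
      Algebra.adjoin K (Set.range y')))
  haveI halg2 : Algebra.IsAlgebraic (integralClosure (Algebra.adjoin K (Set.range y')) B) B := by
    refine Algebra.IsAlgebraic.ringHom_of_comp_eq (R := Algebra.adjoin K (Set.range y)) (A := B)
      (Subring.inclusion (R := B) (S := (Algebra.adjoin K (Set.range y)).toSubring)
       (T := (integralClosure (Algebra.adjoin K (Set.range y')) B).toSubring) hle) (RingHom.id B)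
      ?_ Function.surjective_id rfl
    exact Subring.inclusion_injective hle
  haveI halg3 : Algebra.IsAlgebraic (Algebra.adjoin K (Set.range y')) B :=
    Algebra.IsAlgebraic.trans _ (integralClosure (Algebra.adjoin K (Set.range y')) B) _
  have hy'tb : IsTranscendenceBasis K y' :=
    Algebra.IsAlgebraic.isTranscendenceBasis_of_le_trdeg_of_finite K y'
      hytb.cardinalMk_eq_trdeg.le
  have hy'ind : AlgebraicIndependent K y' := hy'tb.1
  letI : Algebra (MvPolynomial σ K) B := α.toRingHom.toAlgebra
  haveI : IsScalarTower K (MvPolynomial σ K) B := IsScalarTower.of_algebraMap_eq fun r =>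
    (α.commutes r).symm
  haveI : Algebra.IsAlgebraic (MvPolynomial σ K) B := by
    refine Algebra.IsAlgebraic.of_ringHom_of_comp_eq (S := Algebra.adjoin K (Set.range y')) (B := B)
      hy'ind.aevalEquiv.toRingEquiv.toRingHom (RingHom.id B) hy'ind.aevalEquiv.surjective
      Function.injective_id ?_
    refine RingHom.ext fun q => ?_
    exact hy'ind.algebraMap_aevalEquiv q
  obtain ⟨a, hfin, hcard⟩ := core (σ := σ) (K := K) (B := B) hy'ind z' F hFmonic hFprime hFz hFder
  refine ⟨a, fun s => u (some s) * (u none)⁻¹, ?_⟩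
  have hset : {e : B →ₐ[K] K | ∀ s, e (y s) = a s + u (some s) * (u none)⁻¹ * e z} =
    {e : B →ₐ[K] K | ∀ s, e (algebraMap (MvPolynomial σ K) B (MvPolynomial.X s)) = a s} := by
    ext e
    simp only [Set.mem_setOf_eq]
    refine forall_congr' fun s => ?_
    have h1 : algebraMap (MvPolynomial σ K) B (X s) = y s - u (some s) • (u none)⁻¹ • z := by
      change α (X s) = _
      simp [α, y', z']
    rw [h1, map_sub, map_smul, map_smul, smul_eq_mul, smul_eq_mul, sub_eq_iff_eq_add, mul_assoc]
  rw [hset, ← hFdeg]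
  exact ⟨hfin, hcard⟩
end CV

open MvPolynomial
namespace CV

theorem isClosed_iff {K : Type} [Field K] {n : ℕ} (V : Set (Fin n → K)) :
    IsClosed V ↔ ∃ S, V = _root_.zeroLocus K n S := by
  classical
  constructor
  · intro h
    have h1 : TopologicalSpace.GenerateOpen
      {U | ∃ S : Set (MvPolynomial (Fin n) K), U = (_root_.zeroLocus K n S)ᶜ} Vᶜ := h.isOpen_compl
    have : ∀ U, TopologicalSpace.GenerateOpen
      {U | ∃ S : Set (MvPolynomial (Fin n) K), U = (_root_.zeroLocus K n S)ᶜ} U →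
        ∃ S, Uᶜ = _root_.zeroLocus K n S := by
      intro U hU
      induction hU with
      | basic s hs => obtain ⟨S, rfl⟩ := hs; exact ⟨S, compl_compl _⟩
      | univ => exact ⟨{1}, by ext; simp [_root_.zeroLocus]⟩
      | inter s t _ _ hs ht =>
        obtain ⟨A, hA⟩ := hs
        obtain ⟨B, hB⟩ := ht
        refine ⟨{h | ∃ f ∈ A, ∃ g ∈ B, h = f * g}, ?_⟩
        rw [Set.compl_inter, hA, hB]
        ext x
        constructor
        · rintro (hx | hx) _ ⟨f, hf, g, hg, rfl⟩
          · simp [hx f hf]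
          · simp [hx g hg]
        · intro hx
          by_contra hc
          rw [Set.mem_union, not_or] at hc
          obtain ⟨h1, h2⟩ := hc
          simp only [_root_.zeroLocus, Set.mem_setOf_eq, not_forall] at h1 h2
          obtain ⟨f, hf, hf0⟩ := h1
          obtain ⟨g, hg, hg0⟩ := h2
          have := hx (f * g) ⟨f, hf, g, hg, rfl⟩
          rw [map_mul] at this
          exact mul_ne_zero hf0 hg0 this
      | sUnion s _ hs =>
        choose! S hS using hs
        refine ⟨⋃ u ∈ s, S u, ?_⟩
        ext x
        simp only [Set.mem_compl_iff, Set.mem_sUnion, not_exists, not_and, _root_.zeroLocus,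
          Set.mem_iUnion, Set.mem_setOf_eq, forall_exists_index]
        constructor
        · intro h f u hu hf
          have : x ∈ uᶜ := h u hu
          rw [hS u hu] at this
          exact this f hf
        · intro h u hu
          change x ∈ uᶜ
          rw [hS u hu]
          exact fun f hf => h f u hu hf
    obtain ⟨S, hS⟩ := this _ h1
    exact ⟨S, by rw [← hS, compl_compl]⟩
  · rintro ⟨S, rfl⟩
    exact ⟨TopologicalSpace.GenerateOpen.basic _ ⟨S, rfl⟩⟩

theorem zl_eq {K : Type} [Field K] {n : ℕ} (I : Ideal (MvPolynomial (Fin n) K)) :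
    _root_.zeroLocus K n (I : Set _) = MvPolynomial.zeroLocus K I := by
  ext x; simp [_root_.zeroLocus, aeval_eq_eval]

theorem vi_eq {K : Type} [Field K] {n : ℕ} (V : Set (Fin n → K)) :
    _root_.vanishingIdeal K n V = MvPolynomial.vanishingIdeal K V := by
  ext x; simp [_root_.vanishingIdeal, aeval_eq_eval, MvPolynomial.mem_vanishingIdeal_iff]

theorem isClosed_zl {F K : Type} [Field F] [Field K] [Algebra F K] {n : ℕ}
    (I : Ideal (MvPolynomial (Fin n) F)) :
    IsClosed (MvPolynomial.zeroLocus K I) := by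
  rw [isClosed_iff]
  refine ⟨(map (algebraMap F K)) '' I, ?_⟩
  ext x
  simp [_root_.zeroLocus, eval_map, aeval_def]

theorem closed_eq {K : Type} [Field K] {n : ℕ} {V : Set (Fin n → K)} (h : IsClosed V) :
    MvPolynomial.zeroLocus K (MvPolynomial.vanishingIdeal K V) = V := by
  obtain ⟨S, rfl⟩ := (isClosed_iff V).1 h
  refine le_antisymm ?_ (zeroLocus_vanishingIdeal_le _)
  intro x hx f hf
  have := hx f (fun y hy => by rw [aeval_eq_eval]; exact hy f hf)
  rwa [aeval_eq_eval] at this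

theorem prime_of_irred {F K : Type} [Field F] [Field K] [Algebra F K] {n : ℕ} {V : Set (Fin n → K)}
    (h : IsIrreducible V) : (MvPolynomial.vanishingIdeal F V).IsPrime := by
  refine ⟨?_, ?_⟩
  · rw [Ne, Ideal.eq_top_iff_one]
    intro h1
    obtain ⟨x, hx⟩ := h.1
    have := h1 x hx
    simp at this
  · intro f g hfg
    have := (isPreirreducible_iff_isClosed_union_isClosed.1 h.2)
      (MvPolynomial.zeroLocus K (Ideal.span {f})) (MvPolynomial.zeroLocus K (Ideal.span {g}))
      (isClosed_zl _) (isClosed_zl _) ?_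
    · rw [zeroLocus_span, zeroLocus_span] at this
      rcases this with h1 | h1
      · left; intro x hx; exact h1 hx f rfl
      · right; intro x hx; exact h1 hx g rfl
    · intro x hx
      have := hfg x hx
      rw [map_mul, mul_eq_zero] at this
      rw [zeroLocus_span, zeroLocus_span]
      rcases this with h1 | h1
      · left; rintro _ rfl; exact h1
      · right; rintro _ rfl; exact h1

theorem irred_of_prime {K : Type} [Field K] [IsAlgClosed K] {n : ℕ}
    (P : Ideal (MvPolynomial (Fin n) K)) [hP : P.IsPrime] :
    IsIrreducible (MvPolynomial.zeroLocus K P) := by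
  have hvi : MvPolynomial.vanishingIdeal K (MvPolynomial.zeroLocus K P) = P :=
    IsPrime.vanishingIdeal_zeroLocus P
  constructor
  · by_contra h
    rw [Set.not_nonempty_iff_eq_empty] at h
    rw [h, vanishingIdeal_empty] at hvi
    exact hP.ne_top hvi.symm
  · rw [isPreirreducible_iff_isClosed_union_isClosed]
    intro A B hA hB hAB
    by_contra! hc
    obtain ⟨h1, h2⟩ := hc
    rw [← closed_eq hA, ← Set.le_iff_subset, le_zeroLocus_iff_le_vanishingIdeal, hvi] at h1
    rw [← closed_eq hB, ← Set.le_iff_subset, le_zeroLocus_iff_le_vanishingIdeal, hvi] at h2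
    obtain ⟨f, hf, hfP⟩ := SetLike.not_le_iff_exists.1 h1
    obtain ⟨g, hg, hgP⟩ := SetLike.not_le_iff_exists.1 h2
    have : f * g ∈ P := by
      rw [← hvi]
      intro x hx
      rw [map_mul]
      rcases hAB hx with h | h
      · rw [hf x h, zero_mul]
      · rw [hg x h, mul_zero]
    rcases hP.mem_or_mem this with h | h
    · exact hfP h
    · exact hgP h

theorem irred_of_image {X : Type} [TopologicalSpace X] {V : Set X} (Z : Set V)
    (h : IsIrreducible (Subtype.val '' Z)) : IsIrreducible Z := by
  refine ⟨Set.image_nonempty.1 h.1, ?_⟩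
  rintro _ _ ⟨u, hu, rfl⟩ ⟨v, hv, rfl⟩ ⟨x, hx, hxu⟩ ⟨y, hy, hyv⟩
  obtain ⟨_, ⟨w, hw, rfl⟩, hwu, hwv⟩ := h.2 u v hu hv ⟨x, ⟨x, hx, rfl⟩, hxu⟩ ⟨y, ⟨y, hy, rfl⟩, hyv⟩
  exact ⟨w, hw, hwu, hwv⟩

theorem vdim_eq_ring {K : Type} [Field K] [IsAlgClosed K] {n : ℕ} {V : Set (Fin n → K)}
    (hV : IsClosed V) :
    vdim K n V = ringKrullDim (MvPolynomial (Fin n) K ⧸ MvPolynomial.vanishingIdeal K V) := by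
  rw [ringKrullDim_quotient, vdim, topologicalKrullDim]
  have hce : Topology.IsClosedEmbedding (Subtype.val : V → (Fin n → K)) :=
    hV.isClosedEmbedding_subtypeVal
  apply le_antisymm
  · rw [← Order.krullDim_orderDual (α := PrimeSpectrum.zeroLocus _)]
    refine Order.krullDim_le_of_strictMono (fun Z => OrderDual.toDual
      (⟨⟨MvPolynomial.vanishingIdeal K (Subtype.val '' Z.1), prime_of_irred
        (Z.2.image _ continuous_subtype_val.continuousOn)⟩, ?_⟩ : PrimeSpectrum.zeroLocus _)) ?_
    · rw [PrimeSpectrum.mem_zeroLocus]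
      exact vanishingIdeal_anti_mono (by rintro _ ⟨x, _, rfl⟩; exact x.2)
    · refine Monotone.strictMono_of_injective ?_ ?_
      · intro Z Z' h
        change MvPolynomial.vanishingIdeal K (Subtype.val '' Z'.1) ≤
          MvPolynomial.vanishingIdeal K (Subtype.val '' Z.1)
        exact vanishingIdeal_anti_mono (Set.image_mono h)
      · intro Z Z' h
        have h1 : MvPolynomial.vanishingIdeal K (Subtype.val '' Z.1) =
          MvPolynomial.vanishingIdeal K (Subtype.val '' Z'.1) := congrArg (fun q => q.1.1) h
        have h2 := congrArg (MvPolynomial.zeroLocus K) h1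
        rw [closed_eq (hce.isClosedMap _ Z.3), closed_eq (hce.isClosedMap _ Z'.3)] at h2
        have := Set.image_injective.2 Subtype.val_injective h2
        exact TopologicalSpace.IrreducibleCloseds.ext this
  · rw [← Order.krullDim_orderDual (α := PrimeSpectrum.zeroLocus _)]
    have hsub : ∀ P : PrimeSpectrum.zeroLocus
        (MvPolynomial.vanishingIdeal K V : Set (MvPolynomial (Fin n) K)),
        MvPolynomial.zeroLocus K P.1.1 ⊆ V := by
      intro P
      have := zeroLocus_anti_mono (K := K) (PrimeSpectrum.mem_zeroLocus _ _ |>.1 P.2)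
      rwa [closed_eq hV] at this
    have him : ∀ P : PrimeSpectrum.zeroLocus
        (MvPolynomial.vanishingIdeal K V : Set (MvPolynomial (Fin n) K)),
        (Subtype.val '' (Subtype.val ⁻¹' MvPolynomial.zeroLocus K P.1.1 : Set V)) =
          MvPolynomial.zeroLocus K P.1.1 := by
      intro P
      rw [Subtype.image_preimage_coe, Set.inter_eq_right]
      exact hsub P
    refine Order.krullDim_le_of_strictMono (fun P =>
      (⟨Subtype.val ⁻¹' MvPolynomial.zeroLocus K (OrderDual.ofDual P).1.1, ?_,
        (isClosed_zl _).preimage continuous_subtype_val⟩ :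
        TopologicalSpace.IrreducibleCloseds V)) ?_
    · haveI := (OrderDual.ofDual P).1.2
      apply irred_of_image
      rw [him]
      exact irred_of_prime _
    · refine Monotone.strictMono_of_injective ?_ ?_
      · intro P P' h
        have h1 : (OrderDual.ofDual P').1.1 ≤ (OrderDual.ofDual P).1.1 := h
        have h2 : MvPolynomial.zeroLocus K (OrderDual.ofDual P).1.1 ⊆
          MvPolynomial.zeroLocus K (OrderDual.ofDual P').1.1 := zeroLocus_anti_mono h1
        exact fun x hx => h2 hx
      · intro P P' h
        have h1 := congrArg (fun Z => Subtype.val '' Z.1) h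
        simp only at h1
        rw [him, him] at h1
        haveI := (OrderDual.ofDual P).1.2
        haveI := (OrderDual.ofDual P').1.2
        have h2 := congrArg (MvPolynomial.vanishingIdeal K) h1
        rw [IsPrime.vanishingIdeal_zeroLocus, IsPrime.vanishingIdeal_zeroLocus] at h2
        exact OrderDual.ofDual.injective (Subtype.ext (PrimeSpectrum.ext h2))
end CV

open MvPolynomial
namespace CV

theorem dim_integral {R A : Type} [CommRing R] [CommRing A] [Algebra R A]
    [Algebra.IsIntegral R A] (hinj : Function.Injective (algebraMap R A)) :
    ringKrullDim A = ringKrullDim R := by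
  apply le_antisymm
  · refine Order.krullDim_le_of_strictMono (PrimeSpectrum.comap (algebraMap R A)) ?_
    intro P Q h
    haveI := P.2
    exact Ideal.IsIntegral.comap_lt_comap (R := R) (A := A) h
  · rw [ringKrullDim, Order.krullDim]
    refine iSup_le fun l => ?_
    haveI := l.head.2
    obtain ⟨P, -, hP, hPl⟩ := Ideal.exists_ideal_over_prime_of_isIntegral l.head.asIdeal (⊥ : Ideal A)
      (by intro x hx
          have : algebraMap R A x = 0 := hx
          have : x = 0 := hinj (by rw [this, map_zero])
          rw [this]; exact zero_mem _)
    haveI : P.LiesOver l.head.asIdeal := ⟨hPl.symm⟩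
    obtain ⟨L, hL, -⟩ := Ideal.exists_ltSeries_of_hasGoingUp (S := A) l P
    rw [← hL]
    exact le_iSup (fun l : LTSeries (PrimeSpectrum A) => ((l.length : ℕ∞) : WithBot ℕ∞)) L

/-- elementary independence of a set of coordinates modulo an ideal -/
def Ind {k : Type} [Field k] {n : ℕ} (P : Ideal (MvPolynomial (Fin n) k)) (S : Finset (Fin n)) : Prop :=
  ∀ f ∈ P, f.vars ⊆ S → f = 0

/-- elementary algebraicity over a set of coordinates modulo an ideal -/
def Alg {k : Type} [Field k] {n : ℕ} (P : Ideal (MvPolynomial (Fin n) k)) (S : Finset (Fin n)) : Prop :=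
  ∀ i ∉ S, ∃ f ∈ P, f ≠ 0 ∧ f.vars ⊆ insert i S

theorem ai_iff {k τ : Type} [Field k] {n : ℕ} (P : Ideal (MvPolynomial (Fin n) k)) (j : τ → Fin n)
    (hj : Function.Injective j) :
    AlgebraicIndependent k (fun t => Ideal.Quotient.mk P (X (j t))) ↔
      ∀ f ∈ P, (f.vars : Set (Fin n)) ⊆ Set.range j → f = 0 := by
  classical
  have h0 : ∀ q : MvPolynomial τ k, aeval (fun t => Ideal.Quotient.mk P (X (j t))) q =
      Ideal.Quotient.mk P (rename j q) := by
    intro q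
    have : (aeval (fun t => Ideal.Quotient.mk P (X (j t))) : MvPolynomial τ k →ₐ[k] _) =
      (Ideal.Quotient.mkₐ k P).comp (rename j) := by
      ext t; simp
    rw [this]; rfl
  rw [algebraicIndependent_iff]
  constructor
  · intro h f hf hv
    obtain ⟨q, rfl⟩ := exists_rename_eq_of_vars_subset_range f j hj hv
    rw [h q (by rw [h0, Ideal.Quotient.eq_zero_iff_mem]; exact hf), map_zero]
  · intro h q hq
    rw [h0, Ideal.Quotient.eq_zero_iff_mem] at hq
    apply rename_injective j hj
    rw [h _ hq, map_zero]
    intro x hx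
    have := vars_rename j q hx
    obtain ⟨t, -, rfl⟩ := Finset.mem_image.1 this
    exact ⟨t, rfl⟩

theorem ai_of_ind {k : Type} [Field k] {n : ℕ} {P : Ideal (MvPolynomial (Fin n) k)}
    {S : Finset (Fin n)} (h : Ind P S) :
    AlgebraicIndependent k (fun t : S => Ideal.Quotient.mk P (X t.1)) := by
  rw [ai_iff P (fun t : S => t.1) Subtype.val_injective]
  intro f hf hv
  exact h f hf (by simpa using hv)

theorem optinj {n : ℕ} {S : Finset (Fin n)} {i : Fin n} (hi : i ∉ S) :
    Function.Injective (fun o : Option S => o.elim i (fun s => s.1)) := by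
  rintro (_ | s) (_ | t) h
  · rfl
  · simp at h; exact absurd (h ▸ t.2) hi
  · simp at h; exact absurd (h ▸ s.2) hi
  · simp at h; exact congrArg some h

theorem alg_of_alg {k : Type} [Field k] {n : ℕ} {P : Ideal (MvPolynomial (Fin n) k)} [hP : P.IsPrime]
    {S : Finset (Fin n)} (h : Ind P S) (h' : Alg P S) :
    Algebra.IsAlgebraic (Algebra.adjoin k (Set.range (fun t : S => Ideal.Quotient.mk P (X t.1))))
      (MvPolynomial (Fin n) k ⧸ P) := by
  classical
  have hX : ∀ i, IsAlgebraic
      (Algebra.adjoin k (Set.range (fun t : S => Ideal.Quotient.mk P (X t.1))))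
      (Ideal.Quotient.mk P (X i)) := by
    intro i
    by_cases hi : i ∈ S
    · exact isAlgebraic_algebraMap (⟨_, Algebra.subset_adjoin ⟨⟨i, hi⟩, rfl⟩⟩ :
        Algebra.adjoin k (Set.range (fun t : S => Ideal.Quotient.mk P (X t.1))))
    · by_contra hc
      have h1 := ((ai_of_ind h).option_iff_transcendental (Ideal.Quotient.mk P (X i))).2 hc
      have h2 : (fun o : Option S => o.elim (Ideal.Quotient.mk P (X i))
          (fun t : S => Ideal.Quotient.mk P (X t.1))) =
          fun o => Ideal.Quotient.mk P (X ((fun o : Option S => o.elim i (fun s => s.1)) o)) := by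
        funext o; cases o <;> rfl
      rw [h2, ai_iff P (fun o : Option S => o.elim i (fun s => s.1)) (optinj hi)] at h1
      obtain ⟨f, hf, hf0, hv⟩ := h' i hi
      refine hf0 (h1 f hf ?_)
      intro x hx
      rcases Finset.mem_insert.1 (hv hx) with rfl | hxs
      · exact ⟨none, rfl⟩
      · exact ⟨some ⟨x, hxs⟩, rfl⟩
  refine ⟨fun b => ?_⟩
  obtain ⟨q, rfl⟩ := Ideal.Quotient.mk_surjective b
  induction q using MvPolynomial.induction_on with
  | C a =>
    exact isAlgebraic_algebraMap (algebraMap k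
      (Algebra.adjoin k (Set.range (fun t : S => Ideal.Quotient.mk P (X t.1)))) a)
  | add p q hp hq => rw [map_add]; exact hp.add hq
  | mul_X p i hp => rw [map_mul]; exact hp.mul (hX i)

theorem tb_of {k : Type} [Field k] {n : ℕ} {P : Ideal (MvPolynomial (Fin n) k)} [hP : P.IsPrime]
    {S : Finset (Fin n)} (h : Ind P S) (h' : Alg P S) :
    IsTranscendenceBasis k (fun t : S => Ideal.Quotient.mk P (X t.1)) :=
  (ai_of_ind h).isTranscendenceBasis_iff_isAlgebraic.2 (alg_of_alg h h')

theorem ring_dim {k : Type} [Field k] {n : ℕ} {P : Ideal (MvPolynomial (Fin n) k)} [hP : P.IsPrime]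
    {S : Finset (Fin n)} (h : Ind P S) (h' : Alg P S) :
    ringKrullDim (MvPolynomial (Fin n) k ⧸ P) = S.card := by
  obtain ⟨s, -, g, hg, hgi⟩ := exists_integral_inj_algHom_of_quotient P hP.ne_top
  letI : Algebra (MvPolynomial (Fin s) k) (MvPolynomial (Fin n) k ⧸ P) := g.toRingHom.toAlgebra
  haveI : Algebra.IsIntegral (MvPolynomial (Fin s) k) (MvPolynomial (Fin n) k ⧸ P) := ⟨hgi⟩
  rw [dim_integral (R := MvPolynomial (Fin s) k) hg, MvPolynomial.ringKrullDim_of_isNoetherianRing,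
    ringKrullDim_eq_zero_of_field, zero_add]
  have hai : AlgebraicIndependent k (fun i => g (X i)) := by
    have : aeval (fun i => g (X i)) = g := by ext i; simp
    rw [AlgebraicIndependent, this]; exact hg
  have halg : Algebra.IsAlgebraic (Algebra.adjoin k (Set.range (fun i => g (X i))))
      (MvPolynomial (Fin n) k ⧸ P) := by
    haveI : Algebra.IsAlgebraic (MvPolynomial (Fin s) k) (MvPolynomial (Fin n) k ⧸ P) :=
      Algebra.IsIntegral.isAlgebraic
    refine Algebra.IsAlgebraic.ringHom_of_comp_eq (R := MvPolynomial (Fin s) k)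
      (A := MvPolynomial (Fin n) k ⧸ P)
      hai.aevalEquiv.toRingEquiv.toRingHom (RingHom.id _) hai.aevalEquiv.injective
      Function.surjective_id ?_
    refine RingHom.ext fun q => ?_
    refine (hai.algebraMap_aevalEquiv q).trans ?_
    have : aeval (fun i => g (X i)) = g := by ext i; simp
    rw [this]; rfl
  have h1 := (hai.isTranscendenceBasis_iff_isAlgebraic.2 halg).cardinalMk_eq_trdeg
  rw [← (tb_of h h').cardinalMk_eq_trdeg] at h1
  simp at h1
  simp [h1]

theorem vdim_eq {K : Type} [Field K] [IsAlgClosed K] {n : ℕ} {V : Set (Fin n → K)}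
    (hV : IsClosed V) (hp : (MvPolynomial.vanishingIdeal K V).IsPrime) {S : Finset (Fin n)}
    (h : Ind (MvPolynomial.vanishingIdeal K V) S) (h' : Alg (MvPolynomial.vanishingIdeal K V) S) :
    vdim K n V = S.card := by
  rw [vdim_eq_ring hV, ring_dim h h']
end CV

open MvPolynomial
namespace CV

theorem Lfacts {K : Type} [Field K] [IsAlgClosed K] {n : ℕ} (S : Finset (Fin n))
    (lam : Fin n → MvPolynomial (Fin n) K) (hv : ∀ s, (lam s).vars ⊆ Sᶜ)
    (hd : ∀ s, (lam s).totalDegree ≤ 1) :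
    IsAffineSubspace K n {x | ∀ s ∈ S, x s = eval x (lam s)} ∧
      vdim K n {x | ∀ s ∈ S, x s = eval x (lam s)} = (Sᶜ).card := by
  classical
  have hinf : Infinite K := IsAlgClosed.instInfinite
  set L : Set (Fin n → K) := {x | ∀ s ∈ S, x s = eval x (lam s)} with hL
  have hLz : L = _root_.zeroLocus K n {f | ∃ s ∈ S, f = X s - lam s} := by
    ext x
    simp only [hL, _root_.zeroLocus, Set.mem_setOf_eq]
    constructor
    · rintro h _ ⟨s, hs, rfl⟩
      rw [map_sub, eval_X, ← h s hs, sub_self]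
    · intro h s hs
      have := h _ ⟨s, hs, rfl⟩
      rw [map_sub, eval_X] at this
      exact sub_eq_zero.1 this
  have hcl : IsClosed L := (isClosed_iff L).2 ⟨_, hLz⟩
  have hcongr : ∀ (f : MvPolynomial (Fin n) K) (T : Finset (Fin n)) (x y : Fin n → K), f.vars ⊆ T →
      (∀ i ∈ T, x i = y i) → eval x f = eval y f := by
    intro f T x y hT hxy
    exact eval₂Hom_congr' rfl (fun i hi _ => hxy i (hT hi)) rfl
  let sub : Fin n → MvPolynomial (Fin n) K := fun j => if j ∈ S then lam j else X j
  have hpt : ∀ x : Fin n → K, (fun j => eval x (sub j)) ∈ L := by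
    intro x s hs
    have h1 : eval x (sub s) = eval x (lam s) := by simp [sub, hs]
    simp only [h1]
    refine hcongr _ _ _ _ (hv s) fun i hi => ?_
    have : i ∉ S := Finset.mem_compl.1 hi
    simp [sub, this]
  have hptL : ∀ x ∈ L, (fun j => eval x (sub j)) = x := by
    intro x hx
    funext j
    by_cases hj : j ∈ S
    · simp [sub, hj, ← hx j hj]
    · simp [sub, hj]
  have hI : MvPolynomial.vanishingIdeal K L = RingHom.ker (aeval (R := K) sub) := by
    ext f
    rw [mem_vanishingIdeal_iff, RingHom.mem_ker]
    have hev : ∀ x, eval x (aeval sub f) = eval (fun j => eval x (sub j)) f := by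
      intro x
      have := comp_aeval_apply (R := K) (f := sub) (φ := aeval x) f
      simpa [aeval_eq_eval] using this
    constructor
    · intro h
      refine MvPolynomial.funext fun x => ?_
      rw [hev, map_zero]
      simpa [aeval_eq_eval] using h _ (hpt x)
    · intro h x hx
      rw [aeval_eq_eval]
      have := hev x
      rw [h, hptL x hx, map_zero] at this
      exact this.symm
  refine ⟨⟨_, ?_, hLz⟩, ?_⟩
  · rintro _ ⟨s, hs, rfl⟩
    exact (totalDegree_sub _ _).trans (max_le (totalDegree_X _).le (hd s))
  · refine vdim_eq hcl ?_ ?_ ?_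
    · rw [hI]; exact RingHom.ker_isPrime _
    · intro f hf hfv
      refine MvPolynomial.funext fun x => ?_
      have h1 := hf _ (hpt x)
      rw [aeval_eq_eval] at h1
      rw [map_zero, ← h1]
      refine hcongr _ _ _ _ hfv fun i hi => ?_
      have : i ∉ S := Finset.mem_compl.1 hi
      simp [sub, this]
    · intro s hs
      have hs' : s ∈ S := by simpa using hs
      refine ⟨X s - lam s, ?_, ?_, ?_⟩
      · intro x hx
        rw [aeval_eq_eval, map_sub, eval_X, ← hx s hs', sub_self]
      · intro h
        have h1 : X s = lam s := sub_eq_zero.1 h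
        have h2 := hv s
        rw [← h1, vars_X] at h2
        exact hs (h2 (Finset.mem_singleton_self s))
      · refine (vars_sub_subset _).trans (Finset.union_subset ?_ ?_)
        · rw [vars_X]; simp
        · exact (hv s).trans (Finset.subset_insert _ _)

theorem le_irrDegree {K : Type} [Field K] [IsAlgClosed K] {n : ℕ} {W : Set (Fin n → K)}
    (hW : IsClosed W) (hp : (MvPolynomial.vanishingIdeal K W).IsPrime) {S : Finset (Fin n)}
    (h : Ind (MvPolynomial.vanishingIdeal K W) S) (h' : Alg (MvPolynomial.vanishingIdeal K W) S)
    (lam : Fin n → MvPolynomial (Fin n) K) (hv : ∀ s, (lam s).vars ⊆ Sᶜ)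
    (hd : ∀ s, (lam s).totalDegree ≤ 1)
    (hfin : (W ∩ {x | ∀ s ∈ S, x s = eval x (lam s)}).Finite) :
    ((W ∩ {x | ∀ s ∈ S, x s = eval x (lam s)}).ncard : ℕ∞) ≤ irrDegree K n W := by
  obtain ⟨h1, h2⟩ := Lfacts S lam hv hd
  have h3 : vdim K n W + vdim K n {x | ∀ s ∈ S, x s = eval x (lam s)} = (n : WithBot ℕ∞) := by
    rw [vdim_eq hW hp h h', h2]
    have : S.card + Sᶜ.card = n := by rw [Finset.card_add_card_compl]; simp
    exact_mod_cast this
  unfold irrDegree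
  exact le_iSup_of_le _ (le_iSup_of_le h1 (le_iSup_of_le h3 (le_iSup_of_le hfin le_rfl)))

theorem mainLemma {K : Type} [Field K] [IsAlgClosed K] (p : ℕ) [Fact p.Prime] [CharP K p]
    {n : ℕ} {W : Set (Fin n → K)}
    (hW : IsClosed W) (hp : (MvPolynomial.vanishingIdeal K W).IsPrime) {S : Finset (Fin n)}
    (h : Ind (MvPolynomial.vanishingIdeal K W) S) (h' : Alg (MvPolynomial.vanishingIdeal K W) S)
    (i : Fin n) (hi : i ∉ S) :
    ∃ f ∈ MvPolynomial.vanishingIdeal K W, f ≠ 0 ∧ f.vars ⊆ insert i S ∧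
      (f.totalDegree : ℕ∞) ≤ irrDegree K n W := by
  classical
  set Q := MvPolynomial.vanishingIdeal K W with hQ
  obtain ⟨f, hf0, hfz, a, v, hfin, hcard⟩ := AL p (fun t : S => Ideal.Quotient.mk Q (X t.1))
    (ai_of_ind h) (alg_of_alg h h') (Ideal.Quotient.mk Q (X i))
  let j : Option S → Fin n := fun o => o.elim i (fun s => s.1)
  have hj : Function.Injective j := optinj hi
  refine ⟨rename j f, ?_, ?_, ?_, ?_⟩
  · rw [← Ideal.Quotient.eq_zero_iff_mem, ← hfz]
    have : (aeval (fun o : Option S => o.elim (Ideal.Quotient.mk Q (X i))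
        (fun t : S => Ideal.Quotient.mk Q (X t.1))) : MvPolynomial (Option S) K →ₐ[K] _) =
      (Ideal.Quotient.mkₐ K Q).comp (rename j) := by
      ext t; cases t <;> simp [j]
    rw [this]; rfl
  · intro h0
    exact hf0 (rename_injective j hj (by rw [h0, map_zero]))
  · intro x hx
    obtain ⟨t, -, rfl⟩ := Finset.mem_image.1 (vars_rename j f hx)
    cases t with
    | none => simp [j]
    | some s => simp [j]
  · let lam : Fin n → MvPolynomial (Fin n) K := fun s =>
      if hs : s ∈ S then C (a ⟨s, hs⟩) + C (v ⟨s, hs⟩) * X i else 0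
    have hv : ∀ s, (lam s).vars ⊆ Sᶜ := by
      intro s
      by_cases hs : s ∈ S
      · simp only [lam, hs, dif_pos]
        refine (vars_add_subset _ _).trans (Finset.union_subset ?_ ((vars_mul _ _).trans
          (Finset.union_subset ?_ ?_)))
        · simp
        · simp
        · simp [vars_X, hi]
      · simp [lam, hs]
    have hd : ∀ s, (lam s).totalDegree ≤ 1 := by
      intro s
      by_cases hs : s ∈ S
      · simp only [lam, hs, dif_pos]
        refine (totalDegree_add _ _).trans (max_le (by simp) ((totalDegree_mul _ _).trans ?_))
        simp
      · simp [lam, hs]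
    let Φ : ((MvPolynomial (Fin n) K ⧸ Q) →ₐ[K] K) → (Fin n → K) :=
      fun e s => e (Ideal.Quotient.mk Q (X s))
    have hΦ : ∀ e g, e (Ideal.Quotient.mk Q g) = eval (Φ e) g := by
      intro e g
      have : e.comp (Ideal.Quotient.mkₐ K Q) = aeval (Φ e) := by
        ext t; simp [Φ]
      have := DFunLike.congr_fun this g
      rw [aeval_eq_eval] at this
      exact this
    have hΦinj : Function.Injective Φ := by
      intro e e' hee
      ext b
      obtain ⟨g, rfl⟩ := Ideal.Quotient.mk_surjective b
      rw [hΦ, hΦ, hee]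
    have himg : W ∩ {x | ∀ s ∈ S, x s = eval x (lam s)} =
        Φ '' {e | ∀ s : S, e (Ideal.Quotient.mk Q (X s.1)) =
          a s + v s * e (Ideal.Quotient.mk Q (X i))} := by
      ext x
      constructor
      · rintro ⟨hxW, hxL⟩
        let e : (MvPolynomial (Fin n) K ⧸ Q) →ₐ[K] K := Ideal.Quotient.liftₐ Q (aeval x)
          (fun g hg => hg x hxW)
        have he : ∀ s, e (Ideal.Quotient.mk Q (X s)) = x s := by
          intro s
          have : e (Ideal.Quotient.mk Q (X s)) = aeval x (X s) := rfl
          rw [this, aeval_X]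
        refine ⟨e, ?_, funext he⟩
        intro s
        have := hxL s.1 s.2
        simp only [lam, s.2, dif_pos] at this
        simp only [he]
        simpa using this
      · rintro ⟨e, he, rfl⟩
        constructor
        · rw [← closed_eq hW]
          intro g hg
          rw [aeval_eq_eval]
          change eval (Φ e) g = 0
          rw [← hΦ, Ideal.Quotient.eq_zero_iff_mem.2 hg, map_zero]
        · intro s hs
          have := he ⟨s, hs⟩
          simp only [lam, hs, dif_pos]
          simpa [Φ] using this
    have hle := le_irrDegree hW hp h h' lam hv hd (by rw [himg]; exact hfin.image _)
    refine le_trans ?_ hle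
    rw [himg, Set.ncard_image_of_injective _ hΦinj]
    exact_mod_cast (totalDegree_rename_le j f).trans hcard

theorem one_le_irrDegree {K : Type} [Field K] [IsAlgClosed K] (p : ℕ) [Fact p.Prime] [CharP K p]
    {n : ℕ} {W : Set (Fin n → K)}
    (hW : IsClosed W) (hp : (MvPolynomial.vanishingIdeal K W).IsPrime) {S : Finset (Fin n)}
    (h : Ind (MvPolynomial.vanishingIdeal K W) S) (h' : Alg (MvPolynomial.vanishingIdeal K W) S) :
    1 ≤ irrDegree K n W := by
  classical
  by_cases hS : S = Finset.univ
  · have hQ : MvPolynomial.vanishingIdeal K W = ⊥ := by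
      rw [eq_bot_iff]
      intro f hf
      exact h f hf (by rw [hS]; exact Finset.subset_univ _)
    have hWu : W = Set.univ := by
      rw [← closed_eq hW, hQ, zeroLocus_bot]; rfl
    have h1 : W ∩ {x | ∀ s ∈ S, x s = eval x ((fun _ => 0 : Fin n → MvPolynomial (Fin n) K) s)}
        = {0} := by
      rw [hWu, hS]
      ext x
      simp [funext_iff]
    have h2 := le_irrDegree hW hp h h' (fun _ => 0) (by simp) (by simp) (by rw [h1]; simp)
    rw [h1] at h2
    simpa using h2
  · obtain ⟨i, hi⟩ : ∃ i, i ∉ S := by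
      by_contra! hc
      exact hS (Finset.eq_univ_iff_forall.2 hc)
    obtain ⟨f, hf, hf0, -, hfd⟩ := mainLemma p hW hp h h' i hi
    refine le_trans ?_ hfd
    have : f.totalDegree ≠ 0 := by
      intro h0
      rw [totalDegree_eq_zero_iff_eq_C] at h0
      apply hp.ne_top
      rw [h0] at hf
      refine Ideal.eq_top_of_isUnit_mem _ hf (IsUnit.map C (isUnit_iff_ne_zero.2 ?_))
      intro hc
      rw [hc, C_0] at h0
      exact hf0 h0
    exact_mod_cast Nat.one_le_iff_ne_zero.2 this
end CV

open MvPolynomial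
namespace CV

theorem sum_le_tsum_enat {α : Type} (f : α → ℕ∞) (s : Finset α) : ∑ a ∈ s, f a ≤ ∑' a, f a := by
  have h : HasSum f (⨆ s : Finset α, ∑ a ∈ s, f a) :=
    hasSum_of_isLUB _ (isLUB_iSup)
  rw [h.tsum_eq]
  exact le_iSup (fun s : Finset α => ∑ a ∈ s, f a) s

theorem exists_ind_alg {k : Type} [Field k] {n : ℕ} (P : Ideal (MvPolynomial (Fin n) k))
    (hP : P ≠ ⊤) : ∃ S, Ind P S ∧ Alg P S := by
  classical
  have h0 : Ind P ∅ := by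
    intro f hf hv
    have hv' : f.vars = ∅ := Finset.subset_empty.1 hv
    rw [vars_eq_empty_iff_eq_C] at hv'
    rw [hv'] at hf ⊢
    by_contra hne
    apply hP
    refine Ideal.eq_top_of_isUnit_mem _ hf ?_
    have : coeff 0 f ≠ 0 := fun h => hne (by rw [h, C_0])
    exact (IsUnit.mk0 _ this).map C
  obtain ⟨S, hS, hmax⟩ := Finset.exists_max_image (Finset.univ.filter (fun S => Ind P S))
    Finset.card ⟨∅, by simp [h0]⟩
  refine ⟨S, by simpa using hS, ?_⟩
  intro i hi
  by_contra hcon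
  push Not at hcon
  have : Ind P (insert i S) := by
    intro f hf hv
    by_contra hne
    exact hcon f hf hne hv
  have := hmax (insert i S) (by simp [this])
  rw [Finset.card_insert_of_notMem hi] at this
  omega

theorem map_mem_vi {F K : Type} [Field F] [Field K] [Algebra F K] {n : ℕ} (W : Set (Fin n → K))
    (f : MvPolynomial (Fin n) F) :
    map (algebraMap F K) f ∈ MvPolynomial.vanishingIdeal K W ↔ f ∈ MvPolynomial.vanishingIdeal F W := by
  simp only [MvPolynomial.mem_vanishingIdeal_iff, aeval_def, eval₂_map, Algebra.algebraMap_self, RingHom.id_comp]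

theorem ind_ext {F K : Type} [Field F] [Field K] [Algebra F K] [Algebra.IsAlgebraic F K]
    {n : ℕ} (W : Set (Fin n → K)) {S : Finset (Fin n)}
    (h : Ind (MvPolynomial.vanishingIdeal F W) S) : Ind (MvPolynomial.vanishingIdeal K W) S := by
  classical
  have h1 := ai_of_ind h
  let g : (MvPolynomial (Fin n) F ⧸ MvPolynomial.vanishingIdeal F W) →ₐ[F]
      (MvPolynomial (Fin n) K ⧸ MvPolynomial.vanishingIdeal K W) :=
    Ideal.Quotient.liftₐ _ ((Ideal.Quotient.mkₐ F (MvPolynomial.vanishingIdeal K W)).comp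
      (mapAlgHom (Algebra.ofId F K))) (by
        intro f hf
        have : map (algebraMap F K) f ∈ MvPolynomial.vanishingIdeal K W := (map_mem_vi W f).2 hf
        exact Ideal.Quotient.eq_zero_iff_mem.2 this)
  have hg : Function.Injective g := by
    rw [injective_iff_map_eq_zero]
    intro a ha
    obtain ⟨f, rfl⟩ := Ideal.Quotient.mk_surjective a
    have : map (algebraMap F K) f ∈ MvPolynomial.vanishingIdeal K W :=
      Ideal.Quotient.eq_zero_iff_mem.1 ha
    exact Ideal.Quotient.eq_zero_iff_mem.2 ((map_mem_vi W f).1 this)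
  have h2 := (h1.map' hg).extendScalars K
  have h3 : (g ∘ fun t : S => Ideal.Quotient.mk (MvPolynomial.vanishingIdeal F W) (X t.1)) =
      fun t : S => Ideal.Quotient.mk (MvPolynomial.vanishingIdeal K W) (X t.1) := by
    funext t
    change Ideal.Quotient.mk (MvPolynomial.vanishingIdeal K W) (map (algebraMap F K) (X t.1)) = _
    rw [map_X]
  rw [h3, ai_iff _ (fun t : S => t.1) Subtype.val_injective] at h2
  intro f hf hv
  exact h2 f hf (by simpa using hv)

theorem alg_ext {F K : Type} [Field F] [Field K] [Algebra F K]
    {n : ℕ} (W : Set (Fin n → K)) {S : Finset (Fin n)}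
    (h : Alg (MvPolynomial.vanishingIdeal F W) S) : Alg (MvPolynomial.vanishingIdeal K W) S := by
  intro i hi
  obtain ⟨f, hf, h0, hv⟩ := h i hi
  refine ⟨map (algebraMap F K) f, (map_mem_vi W f).2 hf, ?_, ?_⟩
  · intro h
    exact h0 (map_injective _ (algebraMap F K).injective (by rw [h, map_zero]))
  · exact (vars_map _ _).trans hv

theorem eval_conj {K : Type} [Field K] {n : ℕ} (σ : K ≃+* K) (f : MvPolynomial (Fin n) K)
    (x : Fin n → K) : eval (fun i => σ (x i)) (map (σ : K →+* K) f) = σ (eval x f) := by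
  rw [eval_map]
  have := eval₂_comp_left (σ : K →+* K) (RingHom.id K) x f
  rw [show eval x f = eval₂ (RingHom.id K) x f from rfl]
  exact this.symm

theorem descent {F K : Type} [Field F] [Field K] [Algebra F K] [IsGalois F K]
    {n : ℕ} (Z : Set (Fin n → K)) (hZ : ∀ σ : K ≃ₐ[F] K, ∀ x ∈ Z, (fun i => σ (x i)) ∈ Z)
    (f0 : MvPolynomial (Fin n) K) (h0 : f0 ≠ 0) (hf0 : f0 ∈ MvPolynomial.vanishingIdeal K Z) :
    ∃ g : MvPolynomial (Fin n) F, g ≠ 0 ∧ g ∈ MvPolynomial.vanishingIdeal F Z ∧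
      g.support ⊆ f0.support := by
  classical
  obtain ⟨f, ⟨hf, hfne, hfs⟩, hmin⟩ := exists_minimalFor_of_wellFoundedLT
    (fun f : MvPolynomial (Fin n) K => f ∈ MvPolynomial.vanishingIdeal K Z ∧ f ≠ 0 ∧
      f.support ⊆ f0.support) (fun f => f.support.card) ⟨f0, hf0, h0, subset_rfl⟩
  obtain ⟨m, hm⟩ := (support_nonempty.2 hfne)
  have hc : coeff m f ≠ 0 := mem_support_iff.1 hm
  set f' := C (coeff m f)⁻¹ * f with hf'
  have hf'm : coeff m f' = 1 := by rw [hf', coeff_C_mul, inv_mul_cancel₀ hc]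
  have hf's : f'.support = f.support := by
    ext a
    simp [hf', mem_support_iff, coeff_C_mul, hc]
  have hf'v : f' ∈ MvPolynomial.vanishingIdeal K Z := Ideal.mul_mem_left _ _ hf
  have hfix : ∀ σ : K ≃ₐ[F] K, map ((σ : K ≃+* K) : K →+* K) f' = f' := by
    intro σ
    set g := map ((σ : K ≃+* K) : K →+* K) f' with hg
    have hgv : g ∈ MvPolynomial.vanishingIdeal K Z := by
      rw [MvPolynomial.mem_vanishingIdeal_iff]
      intro x hx
      have h1 := eval_conj (σ : K ≃+* K) f' (fun i => σ.symm (x i))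
      have h2 := hf'v _ (hZ σ.symm x hx)
      rw [aeval_eq_eval] at h2 ⊢
      have h3 : (fun i => (σ : K ≃+* K) (σ.symm (x i))) = x := by
        funext i; simp
      have h2' : eval (fun i => σ.symm (x i)) f' = 0 := h2
      rw [h3, h2', map_zero] at h1
      exact h1
    by_contra hne
    have hsub : (g - f').support ⊆ f.support.erase m := by
      intro a ha
      rw [mem_support_iff, coeff_sub, hg, coeff_map] at ha
      rw [Finset.mem_erase]
      constructor
      · rintro rfl
        apply ha
        rw [hf'm]; simp
      · rw [← hf's, mem_support_iff]
        intro h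
        apply ha
        rw [h]; simp
    have hlt : (g - f').support.card < f.support.card :=
      (Finset.card_le_card hsub).trans_lt (Finset.card_erase_lt_of_mem hm)
    have := hmin (j := g - f') ⟨Ideal.sub_mem _ hgv hf'v, sub_ne_zero.2 hne,
      hsub.trans ((Finset.erase_subset _ _).trans hfs)⟩ hlt.le
    exact absurd this (not_le.2 hlt)
  have hr : f' ∈ Set.range (map (algebraMap F K) : MvPolynomial (Fin n) F → MvPolynomial (Fin n) K) := by
    rw [mem_range_map_iff_coeffs_subset]
    intro c hcc
    obtain ⟨a, ha, rfl⟩ := mem_coeffs_iff.1 hcc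
    rw [InfiniteGalois.mem_range_algebraMap_iff_fixed]
    intro σ
    have := congrArg (coeff a) (hfix σ)
    rw [coeff_map] at this
    exact this
  obtain ⟨g, hg⟩ := hr
  refine ⟨g, ?_, ?_, ?_⟩
  · rintro rfl
    rw [map_zero] at hg
    rw [← hg] at hf'm
    simp at hf'm
  · rw [← map_mem_vi, hg]; exact hf'v
  · have : g.support = f'.support := by
      rw [← hg, support_map_of_injective _ (algebraMap F K).injective]
    rw [this, hf's]; exact hfs

theorem vars_of_support {k k' : Type} [Field k] [Field k'] {n : ℕ} {f : MvPolynomial (Fin n) k}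
    {g : MvPolynomial (Fin n) k'} (h : g.support ⊆ f.support) : g.vars ⊆ f.vars := by
  intro i hi
  rw [mem_vars] at hi ⊢
  obtain ⟨d, hd, hi⟩ := hi
  exact ⟨d, h hd, hi⟩

theorem deg_of_support {k k' : Type} [Field k] [Field k'] {n : ℕ} {f : MvPolynomial (Fin n) k}
    {g : MvPolynomial (Fin n) k'} (h : g.support ⊆ f.support) : g.totalDegree ≤ f.totalDegree := by
  rw [totalDegree, totalDegree]
  exact Finset.sup_mono h

end CV

open MvPolynomial
namespace CV

/-- irreducible components as subsets of the ambient space -/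
def comps {K : Type} [Field K] {n : ℕ} (V : Set (Fin n → K)) : Set (Set (Fin n → K)) :=
  {Z | Maximal (fun Z => IsIrreducible Z ∧ Z ⊆ V) Z}

theorem image_mem_comps {K : Type} [Field K] {n : ℕ} {V : Set (Fin n → K)} {W : Set V}
    (hW : W ∈ irreducibleComponents V) : Subtype.val '' W ∈ comps V := by
  refine ⟨⟨hW.1.image _ continuous_subtype_val.continuousOn, ?_⟩, ?_⟩
  · rintro _ ⟨x, -, rfl⟩; exact x.2
  · rintro Z ⟨hZ, hZV⟩ hle
    have h1 : Subtype.val '' (Subtype.val ⁻¹' Z : Set V) = Z := by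
      rw [Subtype.image_preimage_coe]; exact Set.inter_eq_right.2 hZV
    have h2 : IsIrreducible (Subtype.val ⁻¹' Z : Set V) := irred_of_image _ (by rw [h1]; exact hZ)
    have h3 : W ≤ (Subtype.val ⁻¹' Z : Set V) := fun x hx => hle ⟨x, hx, rfl⟩
    have h4 := hW.2 h2 h3
    calc Z = Subtype.val '' (Subtype.val ⁻¹' Z : Set V) := h1.symm
      _ ≤ Subtype.val '' W := Set.image_mono h4

theorem preimage_mem {K : Type} [Field K] {n : ℕ} {V Z : Set (Fin n → K)} (hZ : Z ∈ comps V) :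
    (Subtype.val ⁻¹' Z : Set V) ∈ irreducibleComponents V := by
  have h1 : Subtype.val '' (Subtype.val ⁻¹' Z : Set V) = Z := by
    rw [Subtype.image_preimage_coe]; exact Set.inter_eq_right.2 hZ.1.2
  refine ⟨irred_of_image _ (by rw [h1]; exact hZ.1.1), ?_⟩
  intro Y hY hle x hx
  have h2 : IsIrreducible (Subtype.val '' Y) ∧ Subtype.val '' Y ⊆ V := by
    refine ⟨hY.image _ continuous_subtype_val.continuousOn, ?_⟩
    rintro _ ⟨x, -, rfl⟩; exact x.2
  have h3 : Z ≤ Subtype.val '' Y := by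
    rw [← h1]; exact Set.image_mono hle
  exact hZ.2 h2 h3 ⟨x, hx, rfl⟩

/-- components of the subtype and of the ambient space correspond -/
noncomputable def compEquiv {K : Type} [Field K] {n : ℕ} (V : Set (Fin n → K)) :
    irreducibleComponents V ≃ comps V where
  toFun W := ⟨_, image_mem_comps W.2⟩
  invFun Z := ⟨_, preimage_mem Z.2⟩
  left_inv W := by
    ext1
    exact Set.preimage_image_eq _ Subtype.val_injective
  right_inv Z := by
    ext1
    change Subtype.val '' (Subtype.val ⁻¹' Z.1 : Set V) = Z.1
    rw [Subtype.image_preimage_coe]; exact Set.inter_eq_right.2 Z.2.1.2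

theorem vdeg_eq {K : Type} [Field K] {n : ℕ} (V : Set (Fin n → K)) :
    vdeg K n V = ∑' W : comps V, irrDegree K n W.1 := by
  rw [vdeg, ← (compEquiv V).tsum_eq]
  rfl

theorem exists_comp {K : Type} [Field K] {n : ℕ} {V : Set (Fin n → K)} {x : Fin n → K}
    (hx : x ∈ V) : ∃ W ∈ comps V, x ∈ W := by
  refine ⟨_, image_mem_comps (irreducibleComponent_mem_irreducibleComponents (⟨x, hx⟩ : V)),
    ⟨⟨x, hx⟩, mem_irreducibleComponent, rfl⟩⟩

theorem closed_comp {K : Type} [Field K] {n : ℕ} {V : Set (Fin n → K)} (hV : IsClosed V)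
    {W : Set (Fin n → K)} (hW : W ∈ comps V) : IsClosed W := by
  have h1 : Subtype.val '' (Subtype.val ⁻¹' W : Set V) = W := by
    rw [Subtype.image_preimage_coe]; exact Set.inter_eq_right.2 hW.1.2
  rw [← h1]
  exact hV.isClosedEmbedding_subtypeVal.isClosedMap _
    (isClosed_of_mem_irreducibleComponents _ (preimage_mem hW))

theorem vdim_mono {K : Type} [Field K] {n : ℕ} {V W : Set (Fin n → K)} (h : W ⊆ V) :
    vdim K n W ≤ vdim K n V := by
  refine Topology.IsInducing.topologicalKrullDim_le (f := Set.inclusion h) ?_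
  exact (Topology.IsEmbedding.inclusion h).isInducing

theorem cont_conj {K : Type} [Field K] {n : ℕ} (σ : K ≃+* K) :
    Continuous (fun (x : Fin n → K) => (fun i => σ (x i) : Fin n → K)) := by
  rw [continuous_iff_isClosed]
  intro Z hZ
  obtain ⟨S, rfl⟩ := (isClosed_iff Z).1 hZ
  rw [isClosed_iff]
  refine ⟨(map (σ : K →+* K)) ⁻¹' S, ?_⟩
  ext x
  simp only [_root_.zeroLocus, Set.mem_preimage, Set.mem_setOf_eq]
  constructor
  · intro h f hf
    have := h _ hf
    rw [eval_conj] at this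
    exact (map_eq_zero_iff σ σ.injective).1 this
  · intro h f hf
    have h1 : map (σ : K →+* K) (map (σ.symm : K →+* K) f) = f := by
      rw [map_map]
      convert map_id f
      ext a; simp
    have := h (map (σ.symm : K →+* K) f) (by rw [h1]; exact hf)
    rw [← h1, eval_conj, this, map_zero]

theorem aeval_conj {F K : Type} [Field F] [Field K] [Algebra F K] {n : ℕ} (σ : K ≃ₐ[F] K)
    (f : MvPolynomial (Fin n) F) (x : Fin n → K) :
    aeval (fun i => σ (x i)) f = σ (aeval x f) := by
  have := (map_aeval x ((σ : K ≃+* K) : K →+* K) f).symm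
  have h2 : (((σ : K ≃+* K) : K →+* K).comp (algebraMap F K)) = algebraMap F K := by
    ext a; simp
  rw [h2] at this
  exact this

theorem comps_conj {F K : Type} [Field F] [Field K] [Algebra F K] {n : ℕ} (σ : K ≃ₐ[F] K)
    (I : Ideal (MvPolynomial (Fin n) F)) {W : Set (Fin n → K)}
    (hW : W ∈ comps (MvPolynomial.zeroLocus K I)) :
    ((fun (x : Fin n → K) => (fun i => σ (x i) : Fin n → K)) '' W) ∈ comps (MvPolynomial.zeroLocus K I) := by
  have key : ∀ (τ : K ≃ₐ[F] K) (Z : Set (Fin n → K)), IsIrreducible Z ∧ Z ⊆ MvPolynomial.zeroLocus K I →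
      IsIrreducible ((fun (x : Fin n → K) => (fun i => τ (x i) : Fin n → K)) '' Z) ∧
      ((fun (x : Fin n → K) => (fun i => τ (x i) : Fin n → K)) '' Z) ⊆ MvPolynomial.zeroLocus K I := by
    rintro τ Z ⟨h1, h2⟩
    refine ⟨h1.image _ (cont_conj (τ : K ≃+* K)).continuousOn, ?_⟩
    rintro _ ⟨x, hx, rfl⟩ f hf
    rw [aeval_conj, h2 hx f hf, map_zero]
  refine ⟨key σ W hW.1, ?_⟩
  intro Z hZ hle
  have h1 := key σ.symm Z hZ
  have h2 : W ≤ ((fun (x : Fin n → K) => (fun i => σ.symm (x i) : Fin n → K)) '' Z) := by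
    intro x hx
    refine ⟨_, hle ⟨x, hx, rfl⟩, ?_⟩
    funext i; simp
  have h3 := hW.2 h1 h2
  intro z hz
  refine ⟨_, h3 ⟨z, hz, rfl⟩, ?_⟩
  funext i; simp

theorem vi_conj {F K : Type} [Field F] [Field K] [Algebra F K] {n : ℕ} (σ : K ≃ₐ[F] K)
    (W : Set (Fin n → K)) : MvPolynomial.vanishingIdeal F
    ((fun (x : Fin n → K) => (fun i => σ (x i) : Fin n → K)) '' W) = MvPolynomial.vanishingIdeal F W := by
  ext f
  simp only [MvPolynomial.mem_vanishingIdeal_iff, Set.forall_mem_image, aeval_conj]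
  simp
end CV

open MvPolynomial
namespace CV

/-- primes cut out by low degree relations over few coordinates -/
def PP (F : Type) [Field F] (n k e : ℕ) : Set (Ideal (MvPolynomial (Fin n) F)) :=
  {P | P.IsPrime ∧ ∃ S : Finset (Fin n), S.card ≤ k ∧ Ind P S ∧
    ∀ i ∉ S, ∃ f ∈ P, f ≠ 0 ∧ f.vars ⊆ insert i S ∧ f.totalDegree ≤ e}

theorem data {F K : Type} [Field F] [Fintype F] [Field K] [IsAlgClosed K] [Algebra F K]
    [Algebra.IsAlgebraic F K] {n d k : ℕ} {V : Set (Fin n → K)}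
    (I : Ideal (MvPolynomial (Fin n) F)) (hV : V = MvPolynomial.zeroLocus K I)
    (hd : vdeg K n V = (d : ℕ∞)) (hk : vdim K n V = (k : WithBot ℕ∞)) :
    ∃ (A : Finset (Ideal (MvPolynomial (Fin n) F))) (e : Ideal (MvPolynomial (Fin n) F) → ℕ),
      (∀ P ∈ A, 1 ≤ e P ∧ P ∈ PP F n k (e P)) ∧ ∑ P ∈ A, e P ≤ d ∧
      V = {x | ∀ f ∈ A.inf id, aeval x f = 0} := by
  classical
  obtain ⟨p, hp⟩ := CharP.exists F
  haveI : Fact p.Prime := ⟨CharP.char_is_prime F p⟩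
  haveI : CharP K p := charP_of_injective_algebraMap (algebraMap F K).injective p
  haveI : IsAlgClosure F K := ⟨inferInstance, inferInstance⟩
  haveI : Normal F K := inferInstance
  haveI : Algebra.IsSeparable F K := inferInstance
  haveI : IsGalois F K := {}
  have hcl : IsClosed V := hV ▸ isClosed_zl I
  have hirr : ∀ W ∈ comps V, 1 ≤ irrDegree K n W := by
    intro W hW
    haveI hpr := prime_of_irred (F := F) hW.1.1
    obtain ⟨S, h1, h2⟩ := exists_ind_alg (MvPolynomial.vanishingIdeal F W) hpr.ne_top
    exact one_le_irrDegree p (closed_comp hcl hW) (prime_of_irred hW.1.1) (ind_ext W h1) (alg_ext W h2)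
  rw [vdeg_eq] at hd
  have hsum : ∀ s : Finset (comps V), ∑ W ∈ s, irrDegree K n W.1 ≤ d := by
    intro s; rw [← hd]; exact sum_le_tsum_enat _ s
  have hfin : Finite (comps V) := by
    by_contra h
    rw [not_finite_iff_infinite] at h
    obtain ⟨s, hs⟩ := Infinite.exists_subset_card_eq (comps V) (d + 1)
    have h1 := hsum s
    have h2 : ((d + 1 : ℕ) : ℕ∞) ≤ ∑ W ∈ s, irrDegree K n W.1 := by
      rw [← hs]
      calc ((s.card : ℕ) : ℕ∞) = ∑ W ∈ s, (1 : ℕ∞) := by simp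
        _ ≤ _ := Finset.sum_le_sum fun W _ => hirr W.1 W.2
    have h3 := h2.trans h1
    have : d + 1 ≤ d := by exact_mod_cast h3
    omega
  letI : Fintype (comps V) := Fintype.ofFinite _
  let w : comps V → ℕ := fun W => (irrDegree K n W.1).toNat
  have hw : ∀ W, (w W : ℕ∞) = irrDegree K n W.1 := by
    intro W
    apply ENat.coe_toNat
    have := hsum {W}
    rw [Finset.sum_singleton] at this
    exact ne_top_of_le_ne_top (ENat.coe_ne_top d) this
  have hwd : ∑ W, w W ≤ d := by
    have := hsum Finset.univ
    simp only [← hw] at this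
    exact_mod_cast this
  let PW : comps V → Ideal (MvPolynomial (Fin n) F) := fun W => MvPolynomial.vanishingIdeal F W.1
  let A := Finset.univ.image PW
  let e : Ideal (MvPolynomial (Fin n) F) → ℕ := fun P => ∑ W with PW W = P, w W
  refine ⟨A, e, ?_, ?_, ?_⟩
  · intro P hP
    obtain ⟨W0, -, rfl⟩ := Finset.mem_image.1 hP
    constructor
    · have h1 : 1 ≤ w W0 := by
        have := hirr W0.1 W0.2
        rw [← hw] at this
        exact_mod_cast this
      refine h1.trans ?_
      exact Finset.single_le_sum (f := w) (fun _ _ => Nat.zero_le _) (by simp)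
    · haveI hpr := prime_of_irred (F := F) W0.2.1.1
      refine ⟨hpr, ?_⟩
      obtain ⟨S, h1, h2⟩ := exists_ind_alg (MvPolynomial.vanishingIdeal F W0.1) hpr.ne_top
      refine ⟨S, ?_, h1, ?_⟩
      · have h3 := vdim_eq (closed_comp hcl W0.2) (prime_of_irred W0.2.1.1) (ind_ext W0.1 h1) (alg_ext W0.1 h2)
        have h4 := vdim_mono W0.2.1.2
        rw [h3, hk] at h4
        exact_mod_cast h4
      · intro i hi
        have hW : ∀ W : comps V, PW W = PW W0 → ∃ f ∈ MvPolynomial.vanishingIdeal K W.1, f ≠ 0 ∧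
            f.vars ⊆ insert i S ∧ f.totalDegree ≤ w W := by
          intro W hW
          have h1' : Ind (MvPolynomial.vanishingIdeal F W.1) S := by
            have : MvPolynomial.vanishingIdeal F W.1 = MvPolynomial.vanishingIdeal F W0.1 := hW
            rw [this]; exact h1
          have h2' : Alg (MvPolynomial.vanishingIdeal F W.1) S := by
            have : MvPolynomial.vanishingIdeal F W.1 = MvPolynomial.vanishingIdeal F W0.1 := hW
            rw [this]; exact h2
          obtain ⟨f, hf, hf0, hfv, hfd⟩ := mainLemma p (closed_comp hcl W.2) (prime_of_irred W.2.1.1)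
            (ind_ext W.1 h1') (alg_ext W.1 h2') i hi
          rw [← hw] at hfd
          exact ⟨f, hf, hf0, hfv, by exact_mod_cast hfd⟩
        choose! f hf hf0 hfv hfd using hW
        let h : MvPolynomial (Fin n) K := ∏ W with PW W = PW W0, f W
        have hh0 : h ≠ 0 := Finset.prod_ne_zero_iff.2 fun W hW => hf0 W (by simpa using hW)
        let Z : Set (Fin n → K) := {x | ∃ W : comps V, PW W = PW W0 ∧ x ∈ W.1}
        have hhZ : h ∈ MvPolynomial.vanishingIdeal K Z := by
          rw [MvPolynomial.mem_vanishingIdeal_iff]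
          rintro x ⟨W, hW, hx⟩
          rw [map_prod]
          refine Finset.prod_eq_zero (i := W) (by simpa using hW) (hf W hW x hx)
        have hZ : ∀ σ : K ≃ₐ[F] K, ∀ x ∈ Z, (fun i => σ (x i)) ∈ Z := by
          rintro σ x ⟨W, hW, hx⟩
          have hc : ((fun (x : Fin n → K) => (fun i => σ (x i) : Fin n → K)) '' W.1) ∈ comps V := by
            have h5 : W.1 ∈ comps (MvPolynomial.zeroLocus K I) := (congrArg comps hV) ▸ W.2
            have h6 := comps_conj σ I h5
            rw [← hV] at h6
            exact h6
          refine ⟨⟨_, hc⟩, ?_, ⟨x, hx, rfl⟩⟩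
          rw [← hW]
          exact vi_conj σ W.1
        obtain ⟨g, hg0, hgZ, hgs⟩ := descent Z hZ h hh0 hhZ
        refine ⟨g, ?_, hg0, ?_, ?_⟩
        · intro x hx
          exact hgZ x ⟨W0, rfl, hx⟩
        · refine (vars_of_support hgs).trans ?_
          refine (vars_prod _).trans ?_
          intro j hj
          obtain ⟨W, hW, hj⟩ := Finset.mem_biUnion.1 hj
          exact hfv W (by simpa using hW) hj
        · refine (deg_of_support hgs).trans ?_
          refine (totalDegree_finset_prod _ _).trans ?_
          exact Finset.sum_le_sum fun W hW => hfd W (by simpa using hW)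
  · calc ∑ P ∈ A, e P = ∑ W, w W :=
        Finset.sum_fiberwise_of_maps_to (fun W _ => Finset.mem_image_of_mem _ (Finset.mem_univ W)) _
      _ ≤ d := hwd
  · apply Set.Subset.antisymm
    · intro x hx f hf
      obtain ⟨W, hW, hxW⟩ := exists_comp hx
      have : A.inf id ≤ PW ⟨W, hW⟩ := Finset.inf_le (f := id) (Finset.mem_image_of_mem _ (Finset.mem_univ _))
      exact this hf x hxW
    · intro x hx
      rw [hV]
      intro f hf
      apply hx
      have : I ≤ A.inf id := by
        refine Finset.le_inf ?_
        intro P hP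
        obtain ⟨W0, -, rfl⟩ := Finset.mem_image.1 hP
        intro f hf y hy
        have := W0.2.1.2 hy
        rw [hV] at this
        exact this f hf
      exact this hf

theorem exists_ideal {F K : Type} [Field F] [Field K] [Algebra F K] {n : ℕ} {V : Set (Fin n → K)}
    (h : IsAffineVariety K n V) (h' : DefinedOver F K n V) :
    ∃ I : Ideal (MvPolynomial (Fin n) F), V = MvPolynomial.zeroLocus K I := by
  obtain ⟨s, hs⟩ := h
  have hcl : IsClosed V := (isClosed_iff V).2 ⟨_, hs⟩
  obtain ⟨t, ht⟩ := h'
  refine ⟨Ideal.span t, ?_⟩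
  conv_lhs => rw [← closed_eq hcl, ← vi_eq, ht]
  rw [MvPolynomial.zeroLocus_span, MvPolynomial.zeroLocus_span]
  ext x
  simp [aeval_def, eval_map]
end CV

open MvPolynomial
namespace CV

/-- exponents supported in `T` of degree at most `e` -/
def Mon {n : ℕ} (T : Finset (Fin n)) (e : ℕ) : Finset (Fin n →₀ ℕ) :=
  (Finset.range (e + 1)).biUnion fun j => T.finsuppAntidiag j

theorem card_Mon {n : ℕ} (T : Finset (Fin n)) (e : ℕ) : (Mon T e).card ≤ (T.card + e).choose e := by
  refine Finset.card_biUnion_le.trans ?_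
  simp only [Finset.card_finsuppAntidiag_nat_eq_multichoose]
  rw [Nat.sum_range_multichoose]
  rw [Nat.add_comm e, Nat.choose_symm_add]

/-- polynomials in the variables `T` of degree at most `e` -/
def Pol (F : Type) [Field F] {n : ℕ} (T : Finset (Fin n)) (e : ℕ) : Set (MvPolynomial (Fin n) F) :=
  {f | f.vars ⊆ T ∧ f.totalDegree ≤ e}

theorem supp_Pol {F : Type} [Field F] {n : ℕ} {T : Finset (Fin n)} {e : ℕ} {f : MvPolynomial (Fin n) F}
    (hf : f ∈ Pol F T e) : f.support ⊆ Mon T e := by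
  classical
  intro m hm
  have hs : m.support ⊆ T := by
    intro i hi
    exact hf.1 (mem_vars i |>.2 ⟨m, hm, hi⟩)
  rw [Mon, Finset.mem_biUnion]
  refine ⟨T.sum m, ?_, ?_⟩
  · rw [Finset.mem_range, Nat.lt_succ_iff]
    refine le_trans ?_ ((le_totalDegree hm).trans hf.2)
    rw [Finsupp.sum, ← Finset.sum_subset hs]
    intro i _ hi
    simpa using hi
  · rw [Finset.mem_finsuppAntidiag]
    exact ⟨rfl, hs⟩

theorem card_Pol (F : Type) [Field F] [Fintype F] {n : ℕ} (T : Finset (Fin n)) (e : ℕ) :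
    (Pol F T e).Finite ∧ (Pol F T e).ncard ≤ Fintype.card F ^ ((T.card + e).choose e) := by
  classical
  let φ : MvPolynomial (Fin n) F → (Mon T e → F) := fun f m => coeff m.1 f
  have hinj : Set.InjOn φ (Pol F T e) := by
    intro f hf g hg h
    ext m
    by_cases hm : m ∈ Mon T e
    · exact congrFun h ⟨m, hm⟩
    · rw [notMem_support_iff.1 (fun h => hm (supp_Pol hf h)),
        notMem_support_iff.1 (fun h => hm (supp_Pol hg h))]
  have hfin : (Pol F T e).Finite := Set.Finite.of_finite_image (Set.toFinite _) hinj
  refine ⟨hfin, ?_⟩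
  rw [← Set.ncard_image_of_injOn hinj]
  refine (Set.ncard_le_card _).trans ?_
  rw [Nat.card_eq_fintype_card, Fintype.card_fun, Fintype.card_coe]
  exact Nat.pow_le_pow_right Fintype.card_pos (card_Mon T e)

/-- universal domain for embedding residue rings -/
abbrev Om (F : Type) [Field F] {n : ℕ} (S : Finset (Fin n)) : Type :=
  AlgebraicClosure (FractionRing (MvPolynomial S F))

theorem om_inj (F : Type) [Field F] {n : ℕ} (S : Finset (Fin n)) :
    Function.Injective (algebraMap (MvPolynomial S F) (Om F S)) := by
  rw [IsScalarTower.algebraMap_eq (MvPolynomial S F) (FractionRing (MvPolynomial S F)) (Om F S)]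
  exact (algebraMap (FractionRing (MvPolynomial S F)) (Om F S)).injective.comp
    (IsFractionRing.injective _ _)

theorem embed {F : Type} [Field F] {n : ℕ} {P : Ideal (MvPolynomial (Fin n) F)} [hP : P.IsPrime]
    {S : Finset (Fin n)} (h : Ind P S) (h' : Alg P S) :
    ∃ y : Fin n → Om F S, (∀ s : S, y s.1 = algebraMap (MvPolynomial S F) (Om F S) (X s)) ∧
      ∀ f : MvPolynomial (Fin n) F, f ∈ P ↔ aeval y f = 0 := by
  classical
  have h1 := ai_of_ind h
  haveI halg := alg_of_alg h h'
  let ψ : MvPolynomial S F →ₐ[F] (MvPolynomial (Fin n) F ⧸ P) :=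
    aeval (fun t : S => Ideal.Quotient.mk P (X t.1))
  have hψ : Function.Injective ψ := h1
  letI : Algebra (MvPolynomial S F) (MvPolynomial (Fin n) F ⧸ P) := ψ.toRingHom.toAlgebra
  haveI : IsScalarTower F (MvPolynomial S F) (MvPolynomial (Fin n) F ⧸ P) :=
    IsScalarTower.of_algebraMap_eq fun a => (ψ.commutes a).symm
  haveI : FaithfulSMul (MvPolynomial S F) (MvPolynomial (Fin n) F ⧸ P) :=
    (faithfulSMul_iff_algebraMap_injective _ _).2 hψ
  haveI : FaithfulSMul (MvPolynomial S F) (Om F S) :=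
    (faithfulSMul_iff_algebraMap_injective _ _).2 (om_inj F S)
  haveI : Algebra.IsAlgebraic (MvPolynomial S F) (MvPolynomial (Fin n) F ⧸ P) := by
    constructor
    intro b
    obtain ⟨p, hp0, hp⟩ := halg.isAlgebraic b
    let eqv := h1.aevalEquiv
    refine ⟨p.map (eqv.symm : _ →+* _), ?_, ?_⟩
    · rw [Ne, Polynomial.map_eq_zero_iff]
      · exact hp0
      · exact eqv.symm.injective
    · rw [Polynomial.aeval_def, Polynomial.eval₂_map]
      rw [Polynomial.aeval_def] at hp
      convert hp using 2
      ext a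
      obtain ⟨c, rfl⟩ := eqv.surjective a
      simp only [RingHom.comp_apply]
      change ψ (eqv.symm (eqv c)) = ((eqv c : Algebra.adjoin F _) : MvPolynomial (Fin n) F ⧸ P)
      rw [AlgEquiv.symm_apply_apply]
      simp [eqv, ψ]
  let φ : (MvPolynomial (Fin n) F ⧸ P) →ₐ[MvPolynomial S F] Om F S := IsAlgClosed.lift
  have hφ : Function.Injective φ := by
    rw [injective_iff_map_eq_zero]
    intro b hb
    by_contra hne
    apply Ideal.comap_ne_bot_of_algebraic_mem (R := MvPolynomial S F) (I := RingHom.ker φ) hne hb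
      (Algebra.IsAlgebraic.isAlgebraic b)
    rw [eq_bot_iff]
    intro a ha
    have : φ (algebraMap _ _ a) = 0 := ha
    rw [AlgHom.commutes] at this
    exact (map_eq_zero_iff _ (om_inj F S)).1 this
  refine ⟨fun i => φ (Ideal.Quotient.mk P (X i)), ?_, ?_⟩
  · intro s
    rw [← AlgHom.commutes φ]
    change φ (Ideal.Quotient.mk P (X s.1)) = φ (ψ (X s))
    simp [ψ]
  · intro f
    have h3 : aeval (fun i => φ (Ideal.Quotient.mk P (X i))) f = φ (Ideal.Quotient.mk P f) := by
      have : (aeval (fun i => φ (Ideal.Quotient.mk P (X i))) : MvPolynomial (Fin n) F →ₐ[F] Om F S) =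
        (φ.restrictScalars F).comp (Ideal.Quotient.mkₐ F P) := by
        ext i; simp
      exact DFunLike.congr_fun this f
    rw [h3, map_eq_zero_iff _ hφ, Ideal.Quotient.eq_zero_iff_mem]

end CV

open MvPolynomial
namespace CV

theorem root_poly {F : Type} [Field F] {n e : ℕ} {S : Finset (Fin n)} {i : Fin n} (hi : i ∉ S)
    (f : MvPolynomial (Fin n) F) (hf0 : f ≠ 0) (hv : f.vars ⊆ insert i S) (hd : f.totalDegree ≤ e) :
    ∃ g : Polynomial (Om F S), g ≠ 0 ∧ g.natDegree ≤ e ∧ ∀ y : Fin n → Om F S,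
      (∀ s : S, y s.1 = algebraMap (MvPolynomial S F) (Om F S) (X s)) →
      aeval y f = Polynomial.eval (y i) g := by
  classical
  have hr : (f.vars : Set (Fin n)) ⊆ Set.range (fun o : Option S => o.elim i (fun s => s.1)) := by
    intro j hj
    rcases Finset.mem_insert.1 (hv hj) with h | h
    · exact ⟨none, h.symm⟩
    · exact ⟨some ⟨j, h⟩, rfl⟩
  obtain ⟨p, rfl⟩ := exists_rename_eq_of_vars_subset_range f _ (optinj hi) hr
  refine ⟨(optionEquivLeft F S p).map (algebraMap (MvPolynomial S F) (Om F S)), ?_, ?_, ?_⟩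
  · rw [Ne, Polynomial.map_eq_zero_iff (om_inj F S)]
    intro h
    apply hf0
    have : p = 0 := (map_eq_zero_iff _ (optionEquivLeft F S).injective).1 h
    rw [this, map_zero]
  · refine (Polynomial.natDegree_map_le).trans ?_
    rw [natDegree_optionEquivLeft, ← degreeOf_rename_of_injective (optinj hi)]
    exact (degreeOf_le_totalDegree _ _).trans hd
  · intro y hy
    rw [aeval_rename]
    have : (aeval (y ∘ fun o : Option S => o.elim i (fun s => s.1)) :
        MvPolynomial (Option S) F →ₐ[F] Om F S) =
        ((Polynomial.aeval (R := MvPolynomial S F) (y i)).restrictScalars F).comp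
          (optionEquivLeft F S).toAlgHom := by
      ext o
      rcases o with _ | s
      · simp
      · simp [hy]
    rw [this, Polynomial.eval_map]
    rfl

theorem card_fiber {F : Type} [Field F] {n e : ℕ} (he : 1 ≤ e) (S : Finset (Fin n))
    (f : Fin n → MvPolynomial (Fin n) F) :
    {P : Ideal (MvPolynomial (Fin n) F) | P.IsPrime ∧ Ind P S ∧ ∀ i ∉ S, f i ∈ P ∧ f i ≠ 0 ∧
      (f i).vars ⊆ insert i S ∧ (f i).totalDegree ≤ e}.Finite ∧
    {P : Ideal (MvPolynomial (Fin n) F) | P.IsPrime ∧ Ind P S ∧ ∀ i ∉ S, f i ∈ P ∧ f i ≠ 0 ∧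
      (f i).vars ⊆ insert i S ∧ (f i).totalDegree ≤ e}.ncard ≤ e ^ n := by
  classical
  set Q := {P : Ideal (MvPolynomial (Fin n) F) | P.IsPrime ∧ Ind P S ∧ ∀ i ∉ S, f i ∈ P ∧ f i ≠ 0 ∧
      (f i).vars ⊆ insert i S ∧ (f i).totalDegree ≤ e} with hQ
  rcases Q.eq_empty_or_nonempty with h | ⟨P0, hP0⟩
  · rw [h]; simp
  have hg : ∀ i, i ∉ S → ∃ g : Polynomial (Om F S), g ≠ 0 ∧ g.natDegree ≤ e ∧ ∀ y : Fin n → Om F S,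
      (∀ s : S, y s.1 = algebraMap (MvPolynomial S F) (Om F S) (X s)) →
      aeval y (f i) = Polynomial.eval (y i) g := by
    intro i hi
    obtain ⟨-, h1, h2, h3⟩ := hP0.2.2 i hi
    exact root_poly hi (f i) h1 h2 h3
  choose! g hg0 hgd hgy using hg
  have hy : ∀ P ∈ Q, ∃ y : Fin n → Om F S,
      (∀ s : S, y s.1 = algebraMap (MvPolynomial S F) (Om F S) (X s)) ∧
      ∀ f : MvPolynomial (Fin n) F, f ∈ P ↔ aeval y f = 0 := by
    rintro P ⟨h1, h2, h3⟩
    exact embed h2 (fun i hi => ⟨f i, (h3 i hi).1, (h3 i hi).2.1, (h3 i hi).2.2.1⟩)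
  choose! y hy1 hy2 using hy
  have hinj : Set.InjOn y Q := by
    intro P hP P' hP' h
    ext a
    rw [hy2 P hP, hy2 P' hP', h]
  let R : Fin n → Finset (Om F S) := fun i =>
    if h : i ∈ S then {algebraMap (MvPolynomial S F) (Om F S) (X ⟨i, h⟩)} else (g i).roots.toFinset
  have hR : ∀ i, (R i).card ≤ e := by
    intro i
    by_cases h : i ∈ S
    · simp [R, h, he]
    · simp only [R, h, dite_false]
      exact (Multiset.toFinset_card_le _).trans ((Polynomial.card_roots' _).trans (hgd i h))
  have himg : y '' Q ⊆ (Fintype.piFinset R : Set (Fin n → Om F S)) := by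
    rintro _ ⟨P, hP, rfl⟩
    rw [Finset.mem_coe, Fintype.mem_piFinset]
    intro i
    by_cases h : i ∈ S
    · simp only [R, h, dite_true, Finset.mem_singleton]
      exact hy1 P hP ⟨i, h⟩
    · simp only [R, h, dite_false, Multiset.mem_toFinset]
      rw [Polynomial.mem_roots (hg0 i h), Polynomial.IsRoot, ← hgy i h _ (hy1 P hP)]
      exact (hy2 P hP _).1 (hP.2.2 i h).1
  refine ⟨Set.Finite.of_finite_image ((Finset.finite_toSet _).subset himg) hinj, ?_⟩
  rw [← Set.ncard_image_of_injOn hinj]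
  refine (Set.ncard_le_ncard himg (Finset.finite_toSet _)).trans ?_
  rw [Set.ncard_coe_finset, Fintype.card_piFinset]
  calc ∏ i, (R i).card ≤ ∏ _i : Fin n, e := Finset.prod_le_prod' fun i _ => hR i
    _ = e ^ n := by simp

theorem card_PP {F : Type} [Field F] [Fintype F] {n k e : ℕ} (he : 1 ≤ e) :
    (PP F n k e).Finite ∧
    (PP F n k e).ncard ≤ 2 ^ n * (Fintype.card F ^ ((k + 1 + e).choose e)) ^ n * e ^ n := by
  classical
  let N := Fintype.card F ^ ((k + 1 + e).choose e)
  have hpol : ∀ (S : Finset (Fin n)) (i : Fin n), S.card ≤ k →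
      (Pol F (insert i S) e).ncard ≤ N := by
    intro S i hS
    refine (card_Pol F (insert i S) e).2.trans ?_
    refine Nat.pow_le_pow_right Fintype.card_pos ?_
    refine Nat.choose_le_choose _ ?_
    have := Finset.card_insert_le i S
    omega
  let Fam : Finset (Fin n) → Finset (Fin n → MvPolynomial (Fin n) F) := fun S =>
    Fintype.piFinset fun i => (card_Pol F (insert i S) e).1.toFinset
  have hFam : ∀ S : Finset (Fin n), S.card ≤ k → (Fam S).card ≤ N ^ n := by
    intro S hS
    rw [Fintype.card_piFinset]
    calc _ ≤ ∏ _i : Fin n, N := by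
          refine Finset.prod_le_prod' fun i _ => ?_
          rw [← Set.ncard_eq_toFinset_card _ (card_Pol F (insert i S) e).1]
          exact hpol S i hS
      _ = N ^ n := by simp
  let Q : Finset (Fin n) → (Fin n → MvPolynomial (Fin n) F) → Finset (Ideal (MvPolynomial (Fin n) F)) :=
    fun S f => (card_fiber he S f).1.toFinset
  have hQ : ∀ S f, (Q S f).card ≤ e ^ n := by
    intro S f
    rw [← Set.ncard_eq_toFinset_card _ (card_fiber he S f).1]
    exact (card_fiber he S f).2
  let A := (Finset.univ.filter (fun S : Finset (Fin n) => S.card ≤ k)).biUnion fun S =>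
    (Fam S).biUnion fun f => Q S f
  have hsub : PP F n k e ⊆ A := by
    rintro P ⟨hP, S, hS, hind, h⟩
    choose! f hf hf0 hfv hfd using h
    rw [Finset.mem_coe, Finset.mem_biUnion]
    refine ⟨S, by simpa using hS, ?_⟩
    rw [Finset.mem_biUnion]
    refine ⟨fun i => if i ∈ S then 0 else f i, ?_, ?_⟩
    · rw [Fintype.mem_piFinset]
      intro i
      rw [Set.Finite.mem_toFinset]
      by_cases h : i ∈ S
      · simp [h, Pol]
      · simp only [h, if_false]
        exact ⟨hfv i h, hfd i h⟩
    · rw [Set.Finite.mem_toFinset]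
      refine ⟨hP, hind, ?_⟩
      intro i h
      simp only [h, if_false]
      exact ⟨hf i h, hf0 i h, hfv i h, hfd i h⟩
  refine ⟨(Finset.finite_toSet A).subset hsub, ?_⟩
  refine (Set.ncard_le_ncard hsub (Finset.finite_toSet _)).trans ?_
  rw [Set.ncard_coe_finset]
  refine (Finset.card_biUnion_le_card_mul _ _ (N ^ n * e ^ n) ?_).trans ?_
  · intro S hS
    refine (Finset.card_biUnion_le_card_mul _ _ (e ^ n) fun f _ => hQ S f).trans ?_
    exact Nat.mul_le_mul_right _ (hFam S (by simpa using hS))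
  · rw [mul_assoc]
    refine Nat.mul_le_mul_right _ ?_
    refine (Finset.card_filter_le _ _).trans ?_
    simp
end CV

open MvPolynomial
namespace CV

/-- finite families of weighted elements with total weight at most `d` -/
def Fam {α : Type} (X : ℕ → Set α) (d : ℕ) : Set (Finset α) :=
  {A | ∃ e : α → ℕ, (∀ a ∈ A, 1 ≤ e a ∧ a ∈ X (e a)) ∧ ∑ a ∈ A, e a ≤ d}

theorem two_sum (d : ℕ) : ∑ j ∈ Finset.range d, 2 ^ j + 1 = 2 ^ d := by
  induction d with
  | zero => simp
  | succ d ih => rw [Finset.sum_range_succ, pow_succ]; omega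

theorem card_Fam {α : Type} (X : ℕ → Set α) (T D : ℕ) (hT : 1 ≤ T)
    (hX : ∀ e, 1 ≤ e → e ≤ D → (X e).Finite ∧ (X e).ncard ≤ T ^ e) :
    ∀ d ≤ D, (Fam X d).Finite ∧ (Fam X d).ncard ≤ (2 * T) ^ d := by
  classical
  have hX' : ∀ e : ℕ, ∃ Y : Finset α, 1 ≤ e → e ≤ D → X e = ↑Y ∧ Y.card ≤ T ^ e := by
    intro e
    by_cases h : 1 ≤ e ∧ e ≤ D
    · obtain ⟨h1, h2⟩ := hX e h.1 h.2
      refine ⟨h1.toFinset, fun _ _ => ⟨by simp, ?_⟩⟩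
      rw [← Set.ncard_eq_toFinset_card _ h1]; exact h2
    · exact ⟨∅, fun h1 h2 => absurd ⟨h1, h2⟩ h⟩
  choose Y hY using hX'
  suffices H : ∀ d ≤ D, ∃ G : Finset (Finset α), Fam X d ⊆ ↑G ∧ G.card ≤ (2 * T) ^ d by
    intro d hd
    obtain ⟨G, h1, h2⟩ := H d hd
    refine ⟨(Finset.finite_toSet G).subset h1, ?_⟩
    refine (Set.ncard_le_ncard h1 (Finset.finite_toSet _)).trans ?_
    rw [Set.ncard_coe_finset]; exact h2
  intro d
  induction d using Nat.strong_induction_on with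
  | _ d ih =>
    intro hd
    have ih' : ∀ m, ∃ G : Finset (Finset α), m < d → Fam X m ⊆ ↑G ∧ G.card ≤ (2 * T) ^ m := by
      intro m
      by_cases h : m < d
      · obtain ⟨G, hG⟩ := ih m h (by omega)
        exact ⟨G, fun _ => hG⟩
      · exact ⟨∅, fun h' => absurd h' h⟩
    choose G hG using ih'
    refine ⟨{∅} ∪ (Finset.range d).biUnion (fun j =>
      (Y (j + 1) ×ˢ G (d - 1 - j)).image (fun z => insert z.1 z.2)), ?_, ?_⟩
    · rintro A ⟨e, he, hs⟩
      rw [Finset.mem_coe, Finset.mem_union]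
      rcases A.eq_empty_or_nonempty with h | ⟨a, ha⟩
      · left; simp [h]
      · right
        rw [Finset.mem_biUnion]
        have h1 := he a ha
        have hsum := Finset.add_sum_erase A e ha
        have h2 : e a ≤ d := by omega
        refine ⟨e a - 1, by rw [Finset.mem_range]; omega, ?_⟩
        rw [Finset.mem_image]
        refine ⟨(a, A.erase a), ?_, Finset.insert_erase ha⟩
        rw [Finset.mem_product]
        have h3 : e a - 1 + 1 = e a := by omega
        constructor
        · simp only [h3]
          have := (hY (e a) h1.1 (by omega)).1
          rw [← Finset.mem_coe, ← this]; exact h1.2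
        · apply (hG (d - 1 - (e a - 1)) (by omega)).1
          refine ⟨e, fun b hb => he b (Finset.mem_of_mem_erase hb), ?_⟩
          change ∑ b ∈ A.erase a, e b ≤ _
          omega
    · refine (Finset.card_union_le _ _).trans ?_
      have hb : ((Finset.range d).biUnion (fun j =>
          (Y (j + 1) ×ˢ G (d - 1 - j)).image (fun z => insert z.1 z.2))).card ≤
          ∑ j ∈ Finset.range d, T ^ d * 2 ^ (d - 1 - j) := by
        refine Finset.card_biUnion_le.trans (Finset.sum_le_sum fun j hj => ?_)
        rw [Finset.mem_range] at hj
        refine Finset.card_image_le.trans ?_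
        rw [Finset.card_product]
        refine (Nat.mul_le_mul (hY (j + 1) (by omega) (by omega)).2
          (hG (d - 1 - j) (by omega)).2).trans ?_
        have h4 : d = (j + 1) + (d - 1 - j) := by omega
        have h5 : T ^ d = T ^ (j + 1) * T ^ (d - 1 - j) := by rw [← pow_add, ← h4]
        rw [h5, mul_pow]
        apply le_of_eq; ring
      have h6 : ∑ j ∈ Finset.range d, T ^ d * 2 ^ (d - 1 - j) = T ^ d * ∑ j ∈ Finset.range d, 2 ^ j := by
        rw [← Finset.mul_sum, Finset.sum_range_reflect (fun j => 2 ^ j) d]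
      rw [h6] at hb
      have h7 : 1 ≤ T ^ d := Nat.one_le_pow _ _ hT
      have h8 := two_sum d
      rw [Finset.card_singleton, mul_pow, ← h8]
      nlinarith

theorem choose_bound {k d e : ℕ} (hk : 1 ≤ k) (he : 1 ≤ e) (hed : e ≤ d) :
    (k + 1 + e).choose e ≤ (k + d + 2).choose k * e := by
  have h1 : (k + 1 + e).choose e = (k + 1 + e).choose (k + 1) := by
    rw [Nat.choose_symm_add]
  have h2 := Nat.choose_succ_right_eq (k + 1 + e) k
  have h3 : (k + 1 + e).choose k ≤ (k + d + 2).choose k := Nat.choose_le_choose _ (by omega)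
  have h4 : k + 1 + e - k = e + 1 := by omega
  rw [h4] at h2
  rw [h1]
  have h5 : (k + 1 + e).choose (k + 1) * (k + 1) ≤ ((k + d + 2).choose k * e) * (k + 1) := by
    rw [h2]
    calc (k + 1 + e).choose k * (e + 1) ≤ (k + d + 2).choose k * (e + 1) := Nat.mul_le_mul_right _ h3
      _ ≤ (k + d + 2).choose k * (e * (k + 1)) := Nat.mul_le_mul_left _ (by nlinarith)
      _ = _ := by ring
  exact Nat.le_of_mul_le_mul_right h5 (by omega)

theorem final_bound {q n d k e : ℕ} (hq : 2 ≤ q) (hk : 1 ≤ k) (he : 1 ≤ e) (hed : e ≤ d) :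
    2 ^ n * (q ^ ((k + 1 + e).choose e)) ^ n * e ^ n ≤ (q ^ (3 * n * (k + d + 2).choose k)) ^ e := by
  have hB : 1 ≤ (k + d + 2).choose k := Nat.choose_pos (by omega)
  have hc := choose_bound hk he hed
  set B := (k + d + 2).choose k
  set c := (k + 1 + e).choose e
  have h1 : 2 ^ n ≤ q ^ n := Nat.pow_le_pow_left hq n
  have h2 : e ^ n ≤ (q ^ e) ^ n :=
    Nat.pow_le_pow_left ((Nat.lt_two_pow_self).le.trans (Nat.pow_le_pow_left hq e)) n
  calc 2 ^ n * (q ^ c) ^ n * e ^ n ≤ q ^ n * (q ^ c) ^ n * (q ^ e) ^ n := by gcongr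
    _ = q ^ (n * (1 + c + e)) := by rw [← pow_mul, ← pow_mul, ← pow_add, ← pow_add]; congr 1; ring
    _ ≤ q ^ (n * (3 * (B * e))) := by
        refine Nat.pow_le_pow_right (by omega) (Nat.mul_le_mul_left _ ?_)
        nlinarith
    _ = _ := by rw [← pow_mul]; congr 1; ring

end CV

theorem count_varieties_over_finite_field :
    ∃ C : ℕ, 0 < C ∧
      ∀ (F K : Type) [Field F] [Fintype F] [Field K] [IsAlgClosed K] [Algebra F K]
        [Algebra.IsAlgebraic F K],
        ∀ n d k : ℕ, 1 ≤ n → 1 ≤ d → 1 ≤ k →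
          {V : Set (Fin n → K) | IsAffineVariety K n V ∧ DefinedOver F K n V ∧
              vdeg K n V = (d : ℕ∞) ∧ vdim K n V = (k : WithBot ℕ∞)}.Finite ∧
          {V : Set (Fin n → K) | IsAffineVariety K n V ∧ DefinedOver F K n V ∧
              vdeg K n V = (d : ℕ∞) ∧ vdim K n V = (k : WithBot ℕ∞)}.ncard ≤
            Fintype.card F ^ (n * (C * d * Nat.choose (k + d + 2) k)) := by
  refine ⟨4, by norm_num, ?_⟩
  intro F K _ _ _ _ _ _ n d k hn hd hk
  have hq : 2 ≤ Fintype.card F := Fintype.one_lt_card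
  have hB : 1 ≤ (k + d + 2).choose k := Nat.choose_pos (by omega)
  set T := Fintype.card F ^ (3 * n * (k + d + 2).choose k) with hT
  obtain ⟨h1, h2⟩ := CV.card_Fam (CV.PP F n k) T d (Nat.one_le_pow _ _ (by omega))
    (fun e he hed => ⟨(CV.card_PP he).1, (CV.card_PP he).2.trans (CV.final_bound hq hk he hed)⟩) d le_rfl
  have hsub : {V : Set (Fin n → K) | IsAffineVariety K n V ∧ DefinedOver F K n V ∧
      vdeg K n V = (d : ℕ∞) ∧ vdim K n V = (k : WithBot ℕ∞)} ⊆
      (fun A : Finset (Ideal (MvPolynomial (Fin n) F)) =>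
        {x : Fin n → K | ∀ f ∈ A.inf id, aeval x f = 0}) '' CV.Fam (CV.PP F n k) d := by
    rintro V ⟨ha, hdef, hdeg, hdim⟩
    obtain ⟨I, hI⟩ := CV.exists_ideal ha hdef
    obtain ⟨A, e, hA, hs, hV⟩ := CV.data I hI hdeg hdim
    exact ⟨A, ⟨e, hA, hs⟩, hV.symm⟩
  refine ⟨(h1.image _).subset hsub, ?_⟩
  refine (Set.ncard_le_ncard hsub (h1.image _)).trans ((Set.ncard_image_le h1).trans (h2.trans ?_))
  calc (2 * T) ^ d ≤ (Fintype.card F * T) ^ d := by gcongr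
    _ = Fintype.card F ^ ((1 + 3 * n * (k + d + 2).choose k) * d) := by
        rw [hT, ← pow_succ', ← pow_mul, Nat.add_comm 1]
    _ ≤ _ := by
        refine Nat.pow_le_pow_right (by omega) ?_
        have h3 : 1 ≤ n * (k + d + 2).choose k := Nat.mul_pos hn hB
        calc (1 + 3 * n * (k + d + 2).choose k) * d ≤ (4 * (n * (k + d + 2).choose k)) * d :=
              Nat.mul_le_mul_right _ (by nlinarith)
          _ = _ := by ring
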